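/- arXiv:1112.4310 — 2 statements merged into one kernel-verified Lean document; each statement's English description precedes it below -/
import Mathlib

section
/- Let N = 2 and let S_1 = I_{11}, S_2 = I_{22} be the two diagonal blocks. Then the set of moves of Type I (basic moves) belonging to M_{S_1,S_2} forms the unique minimal Markov basis for the block-wise configuration A_{S_1,S_2}: it is a Markov basis, and every Markov basis for A_{S_1,S_2} contains it. -/
open Finset

namespace Paper

abbrev Table (R C : ℕ) := Fin R × Fin C → ℤ

/-- The table with entry 1 in cell `a` and 0 elsewhere. -/
def e {R C : ℕ} (a : Fin R × Fin C) : Table R C := fun p => if p = a then 1 else 0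

/-- The l1-norm of an integer table. -/
def l1 {R C : ℕ} (z : Table R C) : ℤ := ∑ p : Fin R × Fin C, |z p|

/-- The configuration `A_{S_1,…,S_N}` : row sums, column sums and subtable sums. -/
def configMap {R C N : ℕ} (S : Fin N → Finset (Fin R × Fin C)) (z : Table R C) :
    (Fin R → ℤ) × (Fin C → ℤ) × (Fin N → ℤ) :=
  ⟨fun i => ∑ j, z (i, j), fun j => ∑ i, z (i, j), fun n => ∑ p ∈ S n, z p⟩

/-- A move for `A_{S_1,…,S_N}` : an integer table with vanishing row sums,
column sums and subtable sums. -/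
def IsMove {R C N : ℕ} (S : Fin N → Finset (Fin R × Fin C)) (z : Table R C) : Prop :=
  configMap S z = 0

/-- The fiber `F_t` of the configuration `A_{S_1,…,S_N}` : nonnegative integer tables
with prescribed row sums, column sums and subtable sums. -/
def Fiber {R C N : ℕ} (S : Fin N → Finset (Fin R × Fin C))
    (t : (Fin R → ℤ) × (Fin C → ℤ) × (Fin N → ℤ)) : Set (Table R C) :=
  {x | (∀ p, 0 ≤ x p) ∧ configMap S x = t}

/-- `B` is a Markov basis for the configuration `A_{S_1,…,S_N}`. -/
def IsMarkovBasis {R C N : ℕ} (S : Fin N → Finset (Fin R × Fin C))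
    (B : Set (Table R C)) : Prop :=
  B.Finite ∧ (∀ z ∈ B, IsMove S z) ∧ (∀ z ∈ B, -z ∈ B) ∧
    ∀ t, ∀ x ∈ Fiber S t, ∀ y ∈ Fiber S t, x ≠ y →
      ∃ U : ℕ, 0 < U ∧ ∃ zs : Fin U → Table R C,
        (∀ u, zs u ∈ B) ∧ y = x + ∑ u, zs u ∧
        ∀ u : Fin U, (x + ∑ s ∈ Finset.Iic u, zs s) ∈ Fiber S t

/-- `‖x − y‖₁` can be reduced by the set of moves `B` within the fiber `F`. -/
def CanReduce {R C : ℕ} (F : Set (Table R C)) (B : Set (Table R C))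
    (x y : Table R C) : Prop :=
  ∃ τp τm : ℕ, 0 < τp + τm ∧
    ∃ (Bp : Fin τp → Table R C) (Bm : Fin τm → Table R C),
      (∀ s, Bp s ∈ B) ∧ (∀ s, Bm s ∈ B) ∧
      (∀ u : Fin τp, (x + ∑ s ∈ Finset.Iic u, Bp s) ∈ F) ∧
      (∀ u : Fin τm, (y - ∑ s ∈ Finset.Iic u, Bm s) ∈ F) ∧
      l1 (x - y + ∑ s, Bp s + ∑ s, Bm s) < l1 (x - y)

/-- Basic moves (moves of Type I). -/
def IsBasicMove {R C : ℕ} (z : Table R C) : Prop :=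
  ∃ (i i' : Fin R) (j j' : Fin C), i ≠ i' ∧ j ≠ j' ∧
    z = e (i, j) + e (i', j') - e (i', j) - e (i, j')

/-- A rectangle in the set of cells. -/
def IsRectangle {R C : ℕ} (S : Finset (Fin R × Fin C)) : Prop :=
  ∃ (a₁ a₂ : Fin R) (b₁ b₂ : Fin C), a₁ < a₂ ∧ b₁ < b₂ ∧
    S = Finset.univ.filter fun p => a₁ ≤ p.1 ∧ p.1 ≤ a₂ ∧ b₁ ≤ p.2 ∧ p.2 ≤ b₂

/-- The positive part `z⁺` of a move. -/
def posPart {R C : ℕ} (z : Table R C) : Table R C := fun p => max (z p) 0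

/-- The negative part `z⁻` of a move. -/
def negPart {R C : ℕ} (z : Table R C) : Table R C := fun p => max (-z p) 0

/-- The `(k,l)` block `I_{kl}` (cells are 1-indexed in the paper, hence the `+ 1`). -/
def block {R C : ℕ} (rr cc : ℕ → ℕ) (k l : ℕ) : Finset (Fin R × Fin C) :=
  Finset.univ.filter fun p =>
    rr k ≤ p.1.1 + 1 ∧ p.1.1 + 1 < rr (k+1) ∧ cc l ≤ p.2.1 + 1 ∧ p.2.1 + 1 < cc (l+1)

/-- `S = I_{11} ∪ I_{22} ∪ ⋯ ∪ I_{NN}` : the union of the diagonal blocks. -/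
def Sdiag {R C : ℕ} (N : ℕ) (rr cc : ℕ → ℕ) : Finset (Fin R × Fin C) :=
  (Finset.Icc 1 N).biUnion fun k => block rr cc k k

/-- Two cells lie in a common block `I_{kl}` with `1 ≤ k,l ≤ Nb`. -/
def SameBlock {R C : ℕ} (Nb : ℕ) (rr cc : ℕ → ℕ) (p q : Fin R × Fin C) : Prop :=
  ∃ k l, 1 ≤ k ∧ k ≤ Nb ∧ 1 ≤ l ∧ l ≤ Nb ∧
    p ∈ block (R := R) (C := C) rr cc k l ∧ q ∈ block rr cc k l

/-- Two row indices lie in a common row block `[r_k, r_{k+1})`. -/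
def SameRowBlock {R : ℕ} (Nb : ℕ) (rr : ℕ → ℕ) (i i' : Fin R) : Prop :=
  ∃ k, 1 ≤ k ∧ k ≤ Nb ∧ rr k ≤ i.1 + 1 ∧ i.1 + 1 < rr (k+1) ∧
    rr k ≤ i'.1 + 1 ∧ i'.1 + 1 < rr (k+1)

/-- Moves of Type II: a degree-3 square-free move whose six nonzero cells
lie outside `S` and in six pairwise distinct blocks.  `Nd` bounds the index of the
diagonal blocks of `S`, `Nb` bounds the block indices. -/
def IsTypeII {R C : ℕ} (Nd Nb : ℕ) (rr cc : ℕ → ℕ) (z : Table R C) : Prop :=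
  ∃ (i₁ i₂ i₃ : Fin R) (j₁ j₂ j₃ : Fin C),
    z = e (i₁,j₂) + e (i₂,j₃) + e (i₃,j₁) - e (i₁,j₃) - e (i₂,j₁) - e (i₃,j₂) ∧
    (∀ p ∈ ([(i₁,j₂),(i₂,j₃),(i₃,j₁),(i₁,j₃),(i₂,j₁),(i₃,j₂)] : List (Fin R × Fin C)),
      p ∉ Sdiag Nd rr cc) ∧
    List.Pairwise (fun p q => ¬ SameBlock Nb rr cc p q)
      [(i₁,j₂),(i₂,j₃),(i₃,j₁),(i₁,j₃),(i₂,j₁),(i₃,j₂)]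

/-- Moves of Type III. -/
def IsTypeIII {R C : ℕ} (Nd Nb : ℕ) (rr cc : ℕ → ℕ) (z : Table R C) : Prop :=
  ∃ (i₁ i₂ i₃ : Fin R) (j₁ j₂ j₃ : Fin C),
    z = e (i₁,j₁) + e (i₂,j₃) + e (i₃,j₂) - e (i₁,j₃) - e (i₂,j₂) - e (i₃,j₁) ∧
    (∃ k l, 1 ≤ k ∧ k ≤ Nd ∧ 1 ≤ l ∧ l ≤ Nd ∧ k ≠ l ∧
      (i₁,j₁) ∈ block (R := R) (C := C) rr cc k k ∧ (i₂,j₂) ∈ block rr cc l l) ∧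
    (∀ p ∈ ([(i₂,j₃),(i₃,j₂),(i₁,j₃),(i₃,j₁)] : List (Fin R × Fin C)),
      p ∉ Sdiag Nd rr cc) ∧
    List.Pairwise (fun p q => ¬ SameBlock Nb rr cc p q) [(i₂,j₃),(i₃,j₂),(i₁,j₃),(i₃,j₁)]

/-- Moves of Type IV (row version). -/
def IsTypeIVrow {R C : ℕ} (Nd Nb : ℕ) (rr cc : ℕ → ℕ) (z : Table R C) : Prop :=
  ∃ (i₁ i₂ i₃ i₄ : Fin R) (j₁ j₂ j₃ j₄ : Fin C),
    z = e (i₁,j₁) + e (i₂,j₂) + e (i₃,j₃) + e (i₄,j₄)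
        - e (i₁,j₃) - e (i₂,j₄) - e (i₃,j₂) - e (i₄,j₁) ∧
    (∃ k l, 1 ≤ k ∧ k ≤ Nd ∧ 1 ≤ l ∧ l ≤ Nd ∧ k ≠ l ∧
      (i₁,j₁) ∈ block (R := R) (C := C) rr cc k k ∧ (i₃,j₂) ∈ block rr cc l l) ∧
    (∀ p ∈ ([(i₂,j₂),(i₃,j₃),(i₄,j₄),(i₁,j₃),(i₂,j₄),(i₄,j₁)] : List (Fin R × Fin C)),
      p ∉ Sdiag Nd rr cc) ∧
    SameRowBlock Nb rr i₁ i₂ ∧ SameRowBlock Nb rr i₃ i₄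

/-- Moves of Type IV, including the transposes of the row-version moves. -/
def IsTypeIV {R C : ℕ} (Nd Nb : ℕ) (rr cc : ℕ → ℕ) (z : Table R C) : Prop :=
  IsTypeIVrow Nd Nb rr cc z ∨
    IsTypeIVrow (R := C) (C := R) Nd Nb cc rr (fun p => z (p.2, p.1))

/-- The basic move as a table. -/
def mv {R C : ℕ} (i i' : Fin R) (j j' : Fin C) : Table R C :=
  e (i, j) + e (i', j') - e (i', j) - e (i, j')

theorem mv_apply {R C : ℕ} (i i' : Fin R) (j j' : Fin C) (a : Fin R) (b : Fin C) :
    mv i i' j j' (a, b) = ((if a = i then 1 else 0) - (if a = i' then 1 else 0)) *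
      ((if b = j then 1 else 0) - (if b = j' then 1 else 0)) := by
  simp only [mv, e, Pi.add_apply, Pi.sub_apply, Prod.mk.injEq]
  split_ifs <;> simp_all

theorem mv_nonneg {R C : ℕ} {x : Table R C} (hx : ∀ p, 0 ≤ x p) {i i' : Fin R} {j j' : Fin C}
    (hi : i ≠ i') (hj : j ≠ j')
    (h1 : 0 < x (i', j)) (h2 : 0 < x (i, j')) (p) : 0 ≤ (x + mv i i' j j') p := by
  obtain ⟨a, b⟩ := p
  have := hx (a, b)
  clear hx
  rw [Pi.add_apply, mv_apply]
  split_ifs <;> subst_vars <;> simp_all <;> omega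

theorem cfg_add {R C N : ℕ} (S : Fin N → Finset (Fin R × Fin C)) (x y : Table R C) :
    configMap S (x + y) = configMap S x + configMap S y := by
  simp [configMap, Finset.sum_add_distrib, Prod.ext_iff, funext_iff]

theorem cfg_neg {R C N : ℕ} (S : Fin N → Finset (Fin R × Fin C)) (x : Table R C) :
    configMap S (-x) = - configMap S x := by
  simp [configMap, Prod.ext_iff, funext_iff]

theorem mv_isMove {R C : ℕ} {P : Fin R → Prop} {Q : Fin C → Prop}
    (S : Fin 2 → Finset (Fin R × Fin C))
    (h0 : ∀ p, p ∈ S 0 ↔ P p.1 ∧ Q p.2) (h1 : ∀ p, p ∈ S 1 ↔ ¬ P p.1 ∧ ¬ Q p.2)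
    {i i' : Fin R} {j j' : Fin C} (h : (P i ↔ P i') ∨ (Q j ↔ Q j')) :
    IsMove S (mv i i' j j') := by
  classical
  unfold IsMove configMap
  ext n
  · simp [mv_apply, ← Finset.mul_sum, Finset.sum_sub_distrib]
  · simp [mv_apply, ← Finset.sum_mul, Finset.sum_sub_distrib]
  · fin_cases n
    · simp [mv, e, Finset.sum_sub_distrib, Finset.sum_add_distrib, h0]
      by_cases P i <;> by_cases P i' <;> by_cases Q j <;> by_cases Q j' <;> simp_all
    · simp [mv, e, Finset.sum_sub_distrib, Finset.sum_add_distrib, h1]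
      by_cases P i <;> by_cases P i' <;> by_cases Q j <;> by_cases Q j' <;> simp_all

/-- One step inside a fiber. -/
def Stp {R C : ℕ} (F B : Set (Table R C)) (x y : Table R C) : Prop := y - x ∈ B ∧ y ∈ F

theorem exists_seq {α : Type*} {r : α → α → Prop} {x y : α} (h : Relation.ReflTransGen r x y) :
    ∃ (n : ℕ) (f : ℕ → α), f 0 = x ∧ f n = y ∧ ∀ k < n, r (f k) (f (k + 1)) := by
  induction h with
  | refl => exact ⟨0, fun _ => x, rfl, rfl, by simp⟩
  | @tail b c _ hbc ih =>
    obtain ⟨n, f, h0, hn, hf⟩ := ih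
    refine ⟨n + 1, fun k => if k ≤ n then f k else c, by simp [h0], by simp, ?_⟩
    intro k hk
    rcases Nat.lt_succ_iff_lt_or_eq.1 hk with h | h
    · simp [h.le, Nat.succ_le_of_lt h, hf k h]
    · subst h; simpa [hn] using hbc

theorem sum_Iic_fin {M : Type*} [AddCommMonoid M] {U : ℕ} (g : ℕ → M) (u : Fin U) :
    ∑ s ∈ Finset.Iic u, g s.1 = ∑ k ∈ Finset.range (u.1 + 1), g k := by
  have : Finset.range (u.1 + 1) = (Finset.Iic u).map Fin.valEmbedding := by
    rw [Fin.map_valEmbedding_Iic]; ext; simp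
  rw [this, Finset.sum_map]; rfl

theorem path_of_reach {R C : ℕ} {F B : Set (Table R C)} {x y : Table R C}
    (h : Relation.ReflTransGen (Stp F B) x y) (hne : x ≠ y) :
    ∃ U : ℕ, 0 < U ∧ ∃ zs : Fin U → Table R C,
        (∀ u, zs u ∈ B) ∧ y = x + ∑ u, zs u ∧
        ∀ u : Fin U, (x + ∑ s ∈ Finset.Iic u, zs s) ∈ F := by
  obtain ⟨n, f, h0, hn, hf⟩ := exists_seq h
  refine ⟨n, ?_, fun u => f (u.1 + 1) - f u.1, fun u => (hf u u.2).1, ?_, fun u => ?_⟩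
  · rcases Nat.eq_zero_or_pos n with h | h
    · subst h; exact absurd (h0.symm.trans hn) hne
    · exact h
  · rw [Fin.sum_univ_eq_sum_range (fun k => f (k + 1) - f k), Finset.sum_range_sub, h0, hn]; abel
  · rw [sum_Iic_fin (fun k => f (k + 1) - f k), Finset.sum_range_sub, h0]
    have := (hf u u.2).2
    simpa using this

theorem pos_neg {ι : Type*} {T : Finset ι} {f : ι → ℤ} (h : ∑ i ∈ T, f i = 0)
    {a : ι} (ha : a ∈ T) (hne : f a ≠ 0) : (∃ i ∈ T, f i < 0) ∧ ∃ i ∈ T, 0 < f i := by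
  refine ⟨?_, Finset.exists_pos_of_sum_zero_of_exists_nonzero f h ⟨a, ha, hne⟩⟩
  obtain ⟨i, hi, h'⟩ := Finset.exists_pos_of_sum_zero_of_exists_nonzero (fun i => - f i)
    (by simp [h] : ∑ i ∈ T, - f i = 0) ⟨a, ha, by simpa using hne⟩
  exact ⟨i, hi, by simpa using h'⟩

open Classical in
/-- Column sums over the rows in `P`. -/
noncomputable def us {R C : ℕ} (P : Fin R → Prop) (x : Table R C) (j : Fin C) : ℤ :=
  ∑ i with P i, x (i, j)

theorem us_mv {R C : ℕ} (P : Fin R → Prop) [DecidablePred P] (x : Table R C)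
    (i i' : Fin R) (j j' : Fin C)
    (b : Fin C) : us P (x + mv i i' j j') b = us P x b +
      ((if P i then 1 else 0) - (if P i' then 1 else 0)) *
      ((if b = j then 1 else 0) - (if b = j' then 1 else 0)) := by
  classical
  simp [us, Finset.sum_add_distrib, mv_apply, ← Finset.sum_mul, Finset.sum_sub_distrib]

section
variable {R C : ℕ} {P : Fin R → Prop} {Q : Fin C → Prop}
    {S : Fin 2 → Finset (Fin R × Fin C)}

theorem caseA (h0 : ∀ p, p ∈ S 0 ↔ P p.1 ∧ Q p.2)
    {t} {x y : Table R C} (hx : x ∈ Fiber S t) (hy : y ∈ Fiber S t) (hne : us P x ≠ us P y) :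
    ∃ i i' j j', i ≠ i' ∧ j ≠ j' ∧ (Q j ↔ Q j') ∧ (∀ p, 0 ≤ (x + mv i i' j j') p) ∧
      ∑ b, |us P (x + mv i i' j j') b - us P y b| < ∑ b, |us P x b - us P y b| := by
  classical
  obtain ⟨j0, hj0⟩ := Function.ne_iff.1 hne
  have hc : configMap S x = configMap S y := hx.2.trans hy.2.symm
  simp only [configMap, Prod.mk.injEq, funext_iff] at hc
  obtain ⟨hrow, hcol, hS⟩ := hc
  have key : ∀ z : Table R C, ∑ j with Q j, us P z j = ∑ p ∈ S 0, z p := by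
    intro z
    have : S 0 = (Finset.univ.filter P) ×ˢ (Finset.univ.filter Q) := by
      ext p; simp [h0]
    rw [this, Finset.sum_product_right]; rfl
  have key2 : ∀ z : Table R C, ∑ j, us P z j = ∑ i with P i, ∑ j, z (i, j) := by
    intro z; unfold us; rw [Finset.sum_comm]
  have hQ : ∑ j with Q j, us P x j = ∑ j with Q j, us P y j := by
    rw [key, key, hS]
  have hA : ∑ j, us P x j = ∑ j, us P y j := by
    rw [key2, key2]; exact Finset.sum_congr rfl fun i _ => hrow i
  have hnQ : ∑ j with ¬ Q j, us P x j = ∑ j with ¬ Q j, us P y j := by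
    have a := Finset.sum_filter_add_sum_filter_not Finset.univ Q (us P x)
    have b := Finset.sum_filter_add_sum_filter_not Finset.univ Q (us P y)
    linarith
  have hT : ∑ j with (Q j ↔ Q j0), (us P x j - us P y j) = 0 := by
    rw [Finset.sum_sub_distrib, sub_eq_zero]
    by_cases h : Q j0
    · simpa [h] using hQ
    · simpa [h] using hnQ
  obtain ⟨⟨j1, hj1, h1⟩, ⟨j2, hj2, h2⟩⟩ := pos_neg hT (a := j0) (by simp) (sub_ne_zero.2 hj0)
  simp only [Finset.mem_filter, Finset.mem_univ, true_and] at hj1 hj2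
  have hy2 : 0 ≤ us P y j2 := Finset.sum_nonneg fun i _ => hy.1 _
  have hi : ∃ i, P i ∧ 0 < x (i, j2) := by
    by_contra! hcon
    have : us P x j2 ≤ 0 := Finset.sum_nonpos fun i hi => hcon i (by simpa using hi)
    linarith
  have hi' : ∃ i, ¬ P i ∧ 0 < x (i, j1) := by
    by_contra! hcon
    have a : ∑ i with ¬ P i, x (i, j1) ≤ 0 :=
      Finset.sum_nonpos fun i hi => hcon i (by simpa using hi)
    have b : 0 ≤ ∑ i with ¬ P i, y (i, j1) := Finset.sum_nonneg fun i _ => hy.1 _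
    have c := Finset.sum_filter_add_sum_filter_not Finset.univ P (fun i => x (i, j1))
    have d := Finset.sum_filter_add_sum_filter_not Finset.univ P (fun i => y (i, j1))
    have f := hcol j1
    have g : us P x j1 = ∑ i with P i, x (i, j1) := rfl
    have g' : us P y j1 = ∑ i with P i, y (i, j1) := rfl
    linarith
  obtain ⟨i, hPi, hxi⟩ := hi
  obtain ⟨i', hPi', hxi'⟩ := hi'
  have hij : i ≠ i' := by rintro rfl; exact hPi' hPi
  have hjj : j1 ≠ j2 := by rintro rfl; linarith
  refine ⟨i, i', j1, j2, hij, hjj, hj1.trans hj2.symm, mv_nonneg hx.1 hij hjj hxi' hxi, ?_⟩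
  have hle : ∀ b, |us P (x + mv i i' j1 j2) b - us P y b| ≤ |us P x b - us P y b| := by
    intro b
    rw [us_mv]
    by_cases hb1 : b = j1
    · subst hb1; simp [hPi, hPi', hjj]; rw [abs_of_neg h1, abs_le]; constructor <;> linarith
    · by_cases hb2 : b = j2
      · subst hb2; simp [hPi, hPi', hb1]; rw [abs_of_pos h2, abs_le]; constructor <;> linarith
      · simp [hb1, hb2]
  refine Finset.sum_lt_sum (fun b _ => hle b) ⟨j1, Finset.mem_univ _, ?_⟩
  rw [us_mv]
  simp [hPi, hPi', hjj]
  rw [abs_of_neg h1, abs_of_nonpos] <;> linarith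

theorem caseB
    {t} {x y : Table R C} (hx : x ∈ Fiber S t) (hy : y ∈ Fiber S t) (heq : us P x = us P y)
    (hne : x ≠ y) :
    ∃ i i' j j', i ≠ i' ∧ j ≠ j' ∧ (P i ↔ P i') ∧ (∀ p, 0 ≤ (x + mv i i' j j') p) ∧
      us P (x + mv i i' j j') = us P y ∧ l1 (x + mv i i' j j' - y) < l1 (x - y) := by
  classical
  obtain ⟨⟨i, j0⟩, hj0⟩ := Function.ne_iff.1 hne
  have hc : configMap S x = configMap S y := hx.2.trans hy.2.symm
  simp only [configMap, Prod.mk.injEq, funext_iff] at hc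
  obtain ⟨hrow, hcol, -⟩ := hc
  have hr : ∑ j, (x (i, j) - y (i, j)) = 0 := by
    rw [Finset.sum_sub_distrib, hrow, sub_self]
  obtain ⟨⟨j', -, h1⟩, ⟨j, -, h2⟩⟩ := pos_neg hr (Finset.mem_univ j0) (sub_ne_zero.2 hj0)
  have hT : ∑ k with (P k ↔ P i), (x (k, j') - y (k, j')) = 0 := by
    rw [Finset.sum_sub_distrib, sub_eq_zero]
    have hQ : ∑ i with P i, x (i, j') = ∑ i with P i, y (i, j') := congrFun heq j'
    by_cases h : P i
    · simpa [h] using hQ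
    · have c := Finset.sum_filter_add_sum_filter_not Finset.univ P (fun i => x (i, j'))
      have d := Finset.sum_filter_add_sum_filter_not Finset.univ P (fun i => y (i, j'))
      have f := hcol j'
      simp only [h, iff_false]
      linarith
  obtain ⟨-, ⟨i', hi', h3⟩⟩ := pos_neg hT (a := i) (by simp) h1.ne
  simp only [Finset.mem_filter, Finset.mem_univ, true_and] at hi'
  have hij : i ≠ i' := by rintro rfl; linarith
  have hjj : j' ≠ j := by rintro rfl; linarith
  have hyj := hy.1 (i, j)
  have hyj' := hy.1 (i', j')
  refine ⟨i, i', j', j, hij, hjj, hi'.symm,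
    mv_nonneg hx.1 hij hjj (by linarith) (by linarith), ?_, ?_⟩
  · ext b; rw [us_mv, heq]; simp [hi']
  · have hle : ∀ p, |(x + mv i i' j' j - y) p| ≤
        |(x - y) p| - e (i, j) p - e (i', j') p - e (i, j') p + e (i', j) p := by
      rintro ⟨a, b⟩
      simp only [Pi.add_apply, Pi.sub_apply, mv_apply, e, Prod.mk.injEq]
      by_cases ha : a = i
      · subst ha
        by_cases hb : b = j
        · subst hb; simp [hij, hjj.symm]
          rw [abs_of_pos h2, abs_lt]; constructor <;> omega
        · by_cases hb' : b = j'
          · subst hb'; simp [hij, hb]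
            rw [abs_of_neg h1, abs_lt]; constructor <;> omega
          · simp [hb, hb']
      · by_cases ha' : a = i'
        · subst ha'
          by_cases hb : b = j
          · subst hb; simp [ha, hjj.symm]
            have := abs_add_le (x (a, b) - y (a, b)) 1
            rw [abs_one] at this
            have e1 : x (a, b) + 1 - y (a, b) = x (a, b) - y (a, b) + 1 := by ring
            rw [e1]
            omega
          · by_cases hb' : b = j'
            · subst hb'; simp [ha, hb]
              rw [abs_of_pos h3, abs_lt]; constructor <;> omega
            · simp [hb, hb']
        · simp [ha, ha']
    have hs := Finset.sum_le_sum fun p (_ : p ∈ Finset.univ) => hle p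
    have he : ∀ q : Fin R × Fin C, ∑ p, e q p = 1 := by intro q; simp [e]
    simp only [Finset.sum_add_distrib, Finset.sum_sub_distrib, he] at hs
    unfold l1
    linarith

theorem stp_mk (h0 : ∀ p, p ∈ S 0 ↔ P p.1 ∧ Q p.2) (h1 : ∀ p, p ∈ S 1 ↔ ¬ P p.1 ∧ ¬ Q p.2)
    {t} {x : Table R C} (hx : x ∈ Fiber S t) {i i' : Fin R} {j j' : Fin C}
    (hi : i ≠ i') (hj : j ≠ j') (h : (P i ↔ P i') ∨ (Q j ↔ Q j'))
    (hn : ∀ p, 0 ≤ (x + mv i i' j j') p) :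
    Stp (Fiber S t) {z | IsBasicMove z ∧ IsMove S z} x (x + mv i i' j j') := by
  have hm := mv_isMove S h0 h1 h
  refine ⟨?_, hn, ?_⟩
  · rw [add_sub_cancel_left]; exact ⟨⟨i, i', j, j', hi, hj, rfl⟩, hm⟩
  · rw [cfg_add, hm, add_zero]; exact hx.2

theorem reachB (h0 : ∀ p, p ∈ S 0 ↔ P p.1 ∧ Q p.2) (h1 : ∀ p, p ∈ S 1 ↔ ¬ P p.1 ∧ ¬ Q p.2)
    {t} {y : Table R C} (hy : y ∈ Fiber S t) (n : ℕ) :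
    ∀ x ∈ Fiber S t, us P x = us P y → (l1 (x - y)).toNat = n →
      Relation.ReflTransGen (Stp (Fiber S t) {z | IsBasicMove z ∧ IsMove S z}) x y := by
  induction n using Nat.strong_induction_on with
  | _ n ih =>
    intro x hx hu hn
    by_cases hne : x = y
    · subst hne; exact .refl
    obtain ⟨i, i', j, j', hi, hj, hP, hnn, hu', hlt⟩ := caseB hx hy hu hne
    have hs := stp_mk h0 h1 hx hi hj (Or.inl hP) hnn
    have hpos : 0 ≤ l1 (x + mv i i' j j' - y) := Finset.sum_nonneg fun _ _ => abs_nonneg _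
    exact .head hs (ih _ (by omega) _ hs.2 hu' rfl)

theorem reachA (h0 : ∀ p, p ∈ S 0 ↔ P p.1 ∧ Q p.2) (h1 : ∀ p, p ∈ S 1 ↔ ¬ P p.1 ∧ ¬ Q p.2)
    {t} {y : Table R C} (hy : y ∈ Fiber S t) (n : ℕ) :
    ∀ x ∈ Fiber S t, (∑ b, |us P x b - us P y b|).toNat = n →
      Relation.ReflTransGen (Stp (Fiber S t) {z | IsBasicMove z ∧ IsMove S z}) x y := by
  induction n using Nat.strong_induction_on with
  | _ n ih =>
    intro x hx hn
    by_cases hne : us P x = us P y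
    · exact reachB h0 h1 hy _ x hx hne rfl
    obtain ⟨i, i', j, j', hi, hj, hQ, hnn, hlt⟩ := caseA h0 hx hy hne
    have hs := stp_mk h0 h1 hx hi hj (Or.inr hQ) hnn
    have hpos : 0 ≤ ∑ b, |us P (x + mv i i' j j') b - us P y b| :=
      Finset.sum_nonneg fun _ _ => abs_nonneg _
    exact .head hs (ih _ (by omega) _ hs.2 rfl)

theorem isMB (h0 : ∀ p, p ∈ S 0 ↔ P p.1 ∧ Q p.2) (h1 : ∀ p, p ∈ S 1 ↔ ¬ P p.1 ∧ ¬ Q p.2) :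
    IsMarkovBasis S {z | IsBasicMove z ∧ IsMove S z} := by
  refine ⟨?_, fun z hz => hz.2, ?_, ?_⟩
  · refine (Set.finite_range
      (fun q : Fin R × Fin R × Fin C × Fin C => mv q.1 q.2.1 q.2.2.1 q.2.2.2)).subset ?_
    rintro z ⟨⟨i, i', j, j', -, -, rfl⟩, -⟩
    exact ⟨(i, i', j, j'), rfl⟩
  · rintro z ⟨⟨i, i', j, j', hi, hj, hz⟩, hm⟩
    refine ⟨⟨i', i, j, j', hi.symm, hj, by rw [hz]; abel⟩, ?_⟩
    unfold IsMove at *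
    rw [cfg_neg, hm, neg_zero]
  · intro t x hx y hy hne
    exact path_of_reach (reachA h0 h1 hy _ x hx rfl) hne
end

theorem fiber_two {R C N : ℕ} (S : Fin N → Finset (Fin R × Fin C))
    {i i' : Fin R} {j j' : Fin C} (hi : i ≠ i') (hj : j ≠ j') {w : Table R C}
    (hw : w ∈ Fiber S (configMap S (e (i', j) + e (i, j')))) :
    w = e (i', j) + e (i, j') ∨ w = e (i, j) + e (i', j') := by
  classical
  obtain ⟨hn, hc⟩ := hw
  simp only [configMap, Prod.mk.injEq, funext_iff] at hc
  obtain ⟨hrow, hcol, -⟩ := hc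
  have hR : ∀ a, ∑ b, w (a, b) = (if a = i' then 1 else 0) + (if a = i then 1 else 0) := by
    intro a; rw [hrow]
    simp only [Pi.add_apply, e, Prod.mk.injEq, Finset.sum_add_distrib]
    congr 1 <;> split_ifs <;> simp_all
  have hC : ∀ b, ∑ a, w (a, b) = (if b = j then 1 else 0) + (if b = j' then 1 else 0) := by
    intro b; rw [hcol]
    simp only [Pi.add_apply, e, Prod.mk.injEq, Finset.sum_add_distrib]
    congr 1 <;> split_ifs <;> simp_all
  have z1 : ∀ a b, a ≠ i → a ≠ i' → w (a, b) = 0 := by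
    intro a b h h'
    have := hR a
    simp only [h, h', if_false, add_zero] at this
    exact (Finset.sum_eq_zero_iff_of_nonneg fun b _ => hn (a, b)).1 this b (Finset.mem_univ _)
  have z2 : ∀ a b, b ≠ j → b ≠ j' → w (a, b) = 0 := by
    intro a b h h'
    have := hC b
    simp only [h, h', if_false, add_zero] at this
    exact (Finset.sum_eq_zero_iff_of_nonneg fun a _ => hn (a, b)).1 this a (Finset.mem_univ _)
  have sr : ∀ a, ∑ b, w (a, b) = w (a, j) + w (a, j') := by
    intro a
    exact Fintype.sum_eq_add j j' hj fun b hb => z2 a b hb.1 hb.2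
  have sc : ∀ b, ∑ a, w (a, b) = w (i, b) + w (i', b) := by
    intro b
    exact Fintype.sum_eq_add i i' hi fun a hb => z1 a b hb.1 hb.2
  have r1 := hR i
  have r2 := hR i'
  have c1 := hC j
  have c2 := hC j'
  rw [sr] at r1 r2
  rw [sc] at c1 c2
  simp [hi, hi.symm, hj, hj.symm] at r1 r2 c1 c2
  have n1 := hn (i, j)
  have n2 := hn (i, j')
  have n3 := hn (i', j)
  have n4 := hn (i', j')
  have hcase : w (i, j) = 0 ∨ w (i, j) = 1 := by omega
  rcases hcase with h | h
  · left
    ext ⟨a, b⟩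
    simp only [Pi.add_apply, e, Prod.mk.injEq]
    by_cases ha : a = i
    · subst ha
      by_cases hb : b = j
      · subst hb; simp [hi, hj, h]
      · by_cases hb' : b = j'
        · subst hb'; simp [hi, hb]; omega
        · simp [hb, hb', z2]
    · by_cases ha' : a = i'
      · subst ha'
        by_cases hb : b = j
        · subst hb; simp [ha]; omega
        · by_cases hb' : b = j'
          · subst hb'; simp [ha, hb]; omega
          · simp [hb, hb', z2]
      · simp [ha, ha', z1]
  · right
    ext ⟨a, b⟩
    simp only [Pi.add_apply, e, Prod.mk.injEq]
    by_cases ha : a = i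
    · subst ha
      by_cases hb : b = j
      · subst hb; simp [hi, h]
      · by_cases hb' : b = j'
        · subst hb'; simp [hi, hb]; omega
        · simp [hb, hb', z2]
    · by_cases ha' : a = i'
      · subst ha'
        by_cases hb : b = j
        · subst hb; simp [ha, hj]; omega
        · by_cases hb' : b = j'
          · subst hb'; simp [ha]; omega
          · simp [hb, hb', z2]
      · simp [ha, ha', z1]

theorem basic_mem {R C N : ℕ} (S : Fin N → Finset (Fin R × Fin C)) {B : Set (Table R C)}
    (hB : IsMarkovBasis S B) {z : Table R C} (hz : IsBasicMove z) (hm : IsMove S z) : z ∈ B := by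
  classical
  obtain ⟨i, i', j, j', hi, hj, rfl⟩ := hz
  set x : Table R C := e (i', j) + e (i, j') with hxd
  set y : Table R C := e (i, j) + e (i', j') with hyd
  have hzxy : y - e (i', j) - e (i, j') = y - x := by rw [hxd]; abel
  rw [hzxy] at hm ⊢
  have enn : ∀ a p, 0 ≤ (e a : Table R C) p := by intro a p; unfold e; split_ifs <;> simp
  have hx : x ∈ Fiber S (configMap S x) := ⟨fun p => add_nonneg (enn _ _) (enn _ _), rfl⟩
  have hy : y ∈ Fiber S (configMap S x) := by
    refine ⟨fun p => add_nonneg (enn _ _) (enn _ _), ?_⟩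
    have : y = x + (y - x) := by abel
    rw [this, cfg_add, hm, add_zero]
  have hne : x ≠ y := by
    intro h
    have := congrFun h (i, j)
    simp [hxd, hyd, e, hi, hj] at this
  obtain ⟨U, hU, zs, hzs, hyx, hF⟩ := hB.2.2.2 _ x hx y hy hne
  by_contra hnot
  let g : ℕ → Table R C := fun k => if h : k < U then zs ⟨k, h⟩ else 0
  have hg : ∀ u : Fin U, zs u = g u.1 := fun u => by simp [g]
  have hall : ∀ n ≤ U, x + ∑ k ∈ Finset.range n, g k = x := by
    intro n
    induction n with
    | zero => simp
    | succ n ih =>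
      intro hn
      have ih' := ih (by omega)
      have hF' := hF ⟨n, hn⟩
      simp only [hg] at hF'
      rw [sum_Iic_fin] at hF'
      rcases fiber_two S hi hj hF' with h | h
      · exact h
      · exfalso
        apply hnot
        simp only at h
        rw [Finset.sum_range_succ, ← add_assoc, ih'] at h
        have h2 : y - x = g n := by rw [hyd, ← h]; abel
        rw [h2, ← hg ⟨n, hn⟩]
        exact hzs _
  have := hall U le_rfl
  simp only [hg] at hyx
  rw [Fin.sum_univ_eq_sum_range g U, this] at hyx
  exact hne hyx.symm

/-- for `N = 2` diagonal blocks with individual parameters, the set of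
moves of Type I in `M_{S_1,S_2}` is the unique minimal Markov basis for the
block-wise configuration `A_{S_1,S_2}`. -/
theorem blockDiagonalN2_uniqueMinimalMarkovBasis (R C : ℕ)
    (rr cc : ℕ → ℕ) (hr1 : rr 1 = 1) (hc1 : cc 1 = 1)
    (hrmono : ∀ n, 1 ≤ n → n ≤ 2 → rr n < rr (n + 1))
    (hcmono : ∀ n, 1 ≤ n → n ≤ 2 → cc n < cc (n + 1))
    (hrtop : rr 3 = R + 1) (hctop : cc 3 = C + 1) :
    IsMarkovBasis (fun n : Fin 2 => block (R := R) (C := C) rr cc (n.1 + 1) (n.1 + 1))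
      {z | IsBasicMove z ∧
        IsMove (fun n : Fin 2 => block (R := R) (C := C) rr cc (n.1 + 1) (n.1 + 1)) z} ∧
    ∀ B, IsMarkovBasis
        (fun n : Fin 2 => block (R := R) (C := C) rr cc (n.1 + 1) (n.1 + 1)) B →
      {z | IsBasicMove z ∧
        IsMove (fun n : Fin 2 => block (R := R) (C := C) rr cc (n.1 + 1) (n.1 + 1)) z}
        ⊆ B := by
  refine ⟨isMB (P := fun i => i.1 + 1 < rr 2) (Q := fun j => j.1 + 1 < cc 2) ?_ ?_,
    fun B hB z hz => basic_mem _ hB hz.1 hz.2⟩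
  · rintro ⟨⟨a, ha⟩, ⟨b, hb⟩⟩
    simp [block, hr1, hc1]
  · rintro ⟨⟨a, ha⟩, ⟨b, hb⟩⟩
    simp [block, hrtop, hctop]

end Paper
end

section
/- In the general block diagonal effect model, the set of all moves of Types I, II, III and IV belonging to M_{T_1,…,T_Q} forms a Markov basis for the configuration A_{T_1,…,T_Q}. -/
open Finset

namespace Paper

/-! ### Proof -/

section Proof

variable {R C Q : ℕ}

lemma configMap_add {N : ℕ} (S : Fin N → Finset (Fin R × Fin C)) (x y : Table R C) :
    configMap S (x + y) = configMap S x + configMap S y := by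
  simp only [configMap, Pi.add_apply, Finset.sum_add_distrib]
  rfl

lemma configMap_sub {N : ℕ} (S : Fin N → Finset (Fin R × Fin C)) (x y : Table R C) :
    configMap S (x - y) = configMap S x - configMap S y := by
  simp only [configMap, Pi.sub_apply, Finset.sum_sub_distrib]
  rfl

lemma isMove_neg {N : ℕ} (S : Fin N → Finset (Fin R × Fin C)) (x : Table R C)
    (h : IsMove S x) : IsMove S (-x) := by
  have := configMap_sub S 0 x
  have h0 := configMap_sub S 0 0
  unfold IsMove at *
  simp_all

lemma isMove_iff {N : ℕ} (S : Fin N → Finset (Fin R × Fin C)) (z : Table R C) :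
    IsMove S z ↔ (∀ i, ∑ j, z (i, j) = 0) ∧ (∀ j, ∑ i, z (i, j) = 0) ∧
      ∀ n, ∑ p ∈ S n, z p = 0 := by
  unfold IsMove configMap
  simp [Prod.ext_iff, funext_iff]

lemma e_row (a : Fin R) (b : Fin C) (i : Fin R) :
    ∑ j, e (a, b) (i, j) = if i = a then 1 else 0 := by
  unfold e
  by_cases h : i = a <;> simp [h]

lemma e_col (a : Fin R) (b : Fin C) (j : Fin C) :
    ∑ i, e (a, b) (i, j) = if j = b then 1 else 0 := by
  unfold e
  by_cases h : j = b <;> simp [h]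

lemma e_sub (p : Fin R × Fin C) (T : Finset (Fin R × Fin C)) :
    ∑ r ∈ T, e p r = if p ∈ T then 1 else 0 := by
  unfold e
  simp

lemma e_nonneg (p : Fin R × Fin C) : (0 : Table R C) ≤ e p := by
  intro r; unfold e; simp only [Pi.zero_apply]; split_ifs <;> omega

lemma e_le_one (p r : Fin R × Fin C) : e p r ≤ 1 := by
  unfold e; split_ifs <;> omega

lemma e_self (p : Fin R × Fin C) : e p p = 1 := by simp [e]

lemma e_ne {p r : Fin R × Fin C} (h : p ≠ r) : e p r = 0 := by
  unfold e; rw [if_neg]; exact fun h' => h h'.symm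

lemma e_le {x : Table R C} (hx : 0 ≤ x) {p} (hp : 0 < x p) : e p ≤ x := by
  intro r
  by_cases h : r = p
  · subst h; simp [e]; omega
  · have := hx r; simpa [e, h] using this

lemma add_e_le {x u : Table R C} (hu : u ≤ x) {p} (hp : u p < x p) : u + e p ≤ x := by
  intro r
  by_cases h : r = p
  · subst h; simp [e]; omega
  · have := hu r; simpa [e, h] using this

lemma exists_two {x : Table R C} (hx : 0 ≤ x) (T : Finset (Fin R × Fin C))
    (h : 2 ≤ ∑ p ∈ T, x p) : ∃ p ∈ T, ∃ r ∈ T, 0 < x p ∧ 0 < x r ∧ e p + e r ≤ x := by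
  obtain ⟨p, hp, hp0⟩ : ∃ p ∈ T, 0 < x p := by
    by_contra! hc
    have := Finset.sum_nonpos hc
    omega
  obtain ⟨r, hr, hr0⟩ : ∃ r ∈ T, 0 < (x - e p) r := by
    by_contra! hc
    have := Finset.sum_nonpos hc
    simp only [Pi.sub_apply, Finset.sum_sub_distrib, e_sub, if_pos hp] at this
    omega
  have h1 := e_nonneg p r
  simp only [Pi.sub_apply, Pi.zero_apply] at hr0 h1
  exact ⟨p, hp, r, hr, hp0, by omega, add_e_le (e_le hx hp0) (by omega)⟩

def Step (B : Set (Table R C)) (x y : Table R C) : Prop :=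
  0 ≤ x ∧ 0 ≤ y ∧ y - x ∈ B

def Conn (B : Set (Table R C)) : Table R C → Table R C → Prop :=
  Relation.ReflTransGen (Step B)

lemma Conn.symm' {B : Set (Table R C)} (hB : ∀ z ∈ B, -z ∈ B) {x y : Table R C}
    (h : Conn B x y) : Conn B y x := by
  induction h with
  | refl => exact .refl
  | tail _ hs ih =>
    obtain ⟨h1, h2, h3⟩ := hs
    exact Relation.ReflTransGen.head ⟨h2, h1, by simpa using hB _ h3⟩ ih

lemma Conn.add {B : Set (Table R C)} {x y : Table R C}
    (h : Conn B x y) {u : Table R C} (hu : 0 ≤ u) : Conn B (x + u) (y + u) := by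
  induction h with
  | refl => exact .refl
  | tail _ hs ih =>
    obtain ⟨h1, h2, h3⟩ := hs
    exact Relation.ReflTransGen.tail ih ⟨add_nonneg h1 hu, add_nonneg h2 hu, by simpa using h3⟩

def Tt (ρ : Fin R → ℕ) (κ : Fin C → ℕ) (Nhat : Fin Q → Finset ℕ) (q : Fin Q) :
    Finset (Fin R × Fin C) :=
  univ.filter fun p => ρ p.1 = κ p.2 ∧ ρ p.1 ∈ Nhat q

structure Good (ρ : Fin R → ℕ) (κ : Fin C → ℕ) (Nhat : Fin Q → Finset ℕ)
    (B : Set (Table R C)) : Prop where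
  move : ∀ z ∈ B, IsMove (Tt ρ κ Nhat) z
  neg : ∀ z ∈ B, -z ∈ B
  I : ∀ i i' j j', i ≠ i' → j ≠ j' →
    (∀ q, (if (i, j) ∈ Tt ρ κ Nhat q then (1:ℤ) else 0) +
          (if (i', j') ∈ Tt ρ κ Nhat q then 1 else 0) =
          (if (i', j) ∈ Tt ρ κ Nhat q then 1 else 0) +
          (if (i, j') ∈ Tt ρ κ Nhat q then 1 else 0)) →
    (e (i, j) + e (i', j')) - (e (i', j) + e (i, j')) ∈ B
  II : ∀ i₁ i₂ i₃ j₁ j₂ j₃, ρ i₁ = κ j₁ → ρ i₂ = κ j₂ → ρ i₃ = κ j₃ →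
    ρ i₁ ≠ ρ i₂ → ρ i₁ ≠ ρ i₃ → ρ i₂ ≠ ρ i₃ →
    e (i₁,j₂) + e (i₂,j₃) + e (i₃,j₁) - e (i₁,j₃) - e (i₂,j₁) - e (i₃,j₂) ∈ B
  III : ∀ i₁ i₂ i₃ j₁ j₂ j₃ k l q, k ∈ Nhat q → l ∈ Nhat q → k ≠ l →
    ρ i₁ = k → κ j₁ = k → ρ i₂ = l → κ j₂ = l → ρ i₃ ≠ k → ρ i₃ ≠ l → κ j₃ ≠ k → κ j₃ ≠ l →
    e (i₁,j₁) + e (i₂,j₃) + e (i₃,j₂) - e (i₁,j₃) - e (i₂,j₂) - e (i₃,j₁) ∈ B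
  IVr : ∀ i₁ i₂ i₃ i₄ j₁ j₂ j₃ j₄ k l q, k ∈ Nhat q → l ∈ Nhat q → k ≠ l →
    ρ i₁ = k → ρ i₂ = k → κ j₁ = k → ρ i₃ = l → ρ i₄ = l → κ j₂ = l →
    κ j₃ ≠ k → κ j₃ ≠ l → κ j₄ ≠ k → κ j₄ ≠ l →
    e (i₁,j₁) + e (i₂,j₂) + e (i₃,j₃) + e (i₄,j₄)
        - e (i₁,j₃) - e (i₂,j₄) - e (i₃,j₂) - e (i₄,j₁) ∈ B
  IVc : ∀ i₁ i₂ i₃ i₄ j₁ j₂ j₃ j₄ k l q, k ∈ Nhat q → l ∈ Nhat q → k ≠ l →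
    κ j₁ = k → κ j₂ = k → ρ i₁ = k → κ j₃ = l → κ j₄ = l → ρ i₂ = l →
    ρ i₃ ≠ k → ρ i₃ ≠ l → ρ i₄ ≠ k → ρ i₄ ≠ l →
    e (i₁,j₁) + e (i₂,j₂) + e (i₃,j₃) + e (i₄,j₄)
        - e (i₃,j₁) - e (i₄,j₂) - e (i₂,j₃) - e (i₁,j₄) ∈ B

/-- Nonnegative tables in the same fiber. -/
def SF {N : ℕ} (S : Fin N → Finset (Fin R × Fin C)) (x y : Table R C) : Prop :=
  0 ≤ x ∧ 0 ≤ y ∧ configMap S x = configMap S y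

lemma SF.symm {N : ℕ} {S : Fin N → Finset (Fin R × Fin C)} {x y : Table R C}
    (h : SF S x y) : SF S y x := ⟨h.2.1, h.1, h.2.2.symm⟩

lemma SF.trans {N : ℕ} {S : Fin N → Finset (Fin R × Fin C)} {x y w : Table R C}
    (h : SF S x y) (h' : SF S y w) : SF S x w := ⟨h.1, h'.2.1, h.2.2.trans h'.2.2⟩

lemma SF.row {N : ℕ} {S : Fin N → Finset (Fin R × Fin C)} {x y : Table R C}
    (h : SF S x y) (i : Fin R) : ∑ j, x (i, j) = ∑ j, y (i, j) :=
  congrFun (congrArg Prod.fst h.2.2) i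

lemma SF.col {N : ℕ} {S : Fin N → Finset (Fin R × Fin C)} {x y : Table R C}
    (h : SF S x y) (j : Fin C) : ∑ i, x (i, j) = ∑ i, y (i, j) :=
  congrFun (congrArg (fun t => t.2.1) h.2.2) j

lemma SF.sub {N : ℕ} {S : Fin N → Finset (Fin R × Fin C)} {x y : Table R C}
    (h : SF S x y) (q) : ∑ p ∈ S q, x p = ∑ p ∈ S q, y p :=
  congrFun (congrArg (fun t => t.2.2) h.2.2) q

lemma SF.rowTypes {N : ℕ} {S : Fin N → Finset (Fin R × Fin C)} {x y : Table R C}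
    (h : SF S x y) (P : Fin R → Prop) [DecidablePred P] :
    ∑ p ∈ univ.filter (fun p : Fin R × Fin C => P p.1), x p =
    ∑ p ∈ univ.filter (fun p : Fin R × Fin C => P p.1), y p := by
  rw [Finset.sum_filter, Finset.sum_filter, Fintype.sum_prod_type, Fintype.sum_prod_type]
  refine Finset.sum_congr rfl fun i _ => ?_
  by_cases hi : P i
  · simpa [hi] using h.row i
  · simp [hi]

lemma SF.colTypes {N : ℕ} {S : Fin N → Finset (Fin R × Fin C)} {x y : Table R C}
    (h : SF S x y) (P : Fin C → Prop) [DecidablePred P] :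
    ∑ p ∈ univ.filter (fun p : Fin R × Fin C => P p.2), x p =
    ∑ p ∈ univ.filter (fun p : Fin R × Fin C => P p.2), y p := by
  rw [Finset.sum_filter, Finset.sum_filter, Fintype.sum_prod_type_right,
    Fintype.sum_prod_type_right]
  refine Finset.sum_congr rfl fun i _ => ?_
  by_cases hi : P i
  · simpa [hi] using h.col i
  · simp [hi]

lemma SF.tot {N : ℕ} {S : Fin N → Finset (Fin R × Fin C)} {x y : Table R C}
    (h : SF S x y) : ∑ p, x p = ∑ p, y p := by
  simpa using h.rowTypes (fun _ => True)

lemma exists_pos {ι : Type*} {s t : Finset ι} {f g : ι → ℤ} (hf : ∀ i ∈ s, 0 ≤ f i)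
    {i} (hi : i ∈ s) (hpos : 0 < f i) (h : ∑ i ∈ s, f i = ∑ i ∈ t, g i) :
    ∃ j ∈ t, 0 < g j := by
  by_contra! hc
  have h1 := Finset.sum_nonpos hc
  have h2 := Finset.single_le_sum hf hi
  omega

lemma SF.exRow {N : ℕ} {S : Fin N → Finset (Fin R × Fin C)} {x y : Table R C}
    (h : SF S x y) {i j} (hx : 0 < x (i, j)) : ∃ j', 0 < y (i, j') := by
  obtain ⟨j', -, h'⟩ := exists_pos (fun j _ => h.1 (i, j)) (Finset.mem_univ j) hx (h.row i)
  exact ⟨j', h'⟩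

lemma SF.exCol {N : ℕ} {S : Fin N → Finset (Fin R × Fin C)} {x y : Table R C}
    (h : SF S x y) {i j} (hx : 0 < x (i, j)) : ∃ i', 0 < y (i', j) := by
  obtain ⟨j', -, h'⟩ := exists_pos (fun i _ => h.1 (i, j)) (Finset.mem_univ i) hx (h.col j)
  exact ⟨j', h'⟩

section Main

variable {ρ : Fin R → ℕ} {κ : Fin C → ℕ} {Nhat : Fin Q → Finset ℕ} {B : Set (Table R C)}

lemma apply_move (hB : Good ρ κ Nhat B) {x u u' : Table R C} (hx : 0 ≤ x) (hu : u ≤ x)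
    (hu' : 0 ≤ u') (hz : u' - u ∈ B) :
    ∃ x', Conn B x x' ∧ SF (Tt ρ κ Nhat) x x' ∧ u' ≤ x' := by
  have h0 : 0 ≤ x - u + u' := add_nonneg (sub_nonneg.2 hu) hu'
  refine ⟨x - u + u', Relation.ReflTransGen.single ⟨hx, h0, ?_⟩, ⟨hx, h0, ?_⟩, ?_⟩
  · convert hz using 1; abel
  · have := hB.move _ hz
    unfold IsMove at this
    have e1 : x - u + u' = x + (u' - u) := by abel
    rw [e1, configMap_add, this, add_zero]
  · exact le_add_of_nonneg_left (sub_nonneg.2 hu)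

/-- induction hypothesis -/
def IH (ρ : Fin R → ℕ) (κ : Fin C → ℕ) (Nhat : Fin Q → Finset ℕ) (B : Set (Table R C))
    (d : ℤ) : Prop :=
  ∀ x y : Table R C, SF (Tt ρ κ Nhat) x y → ∑ p, x p < d → Conn B x y

lemma share {x y : Table R C} (ih : IH ρ κ Nhat B (∑ p, x p))
    (h : SF (Tt ρ κ Nhat) x y) {p} (hx : 0 < x p) (hy : 0 < y p) : Conn B x y := by
  have h1 : Conn B (x - e p) (y - e p) := by
    apply ih
    · refine ⟨sub_nonneg.2 (e_le h.1 hx), sub_nonneg.2 (e_le h.2.1 hy), ?_⟩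
      rw [configMap_sub, configMap_sub, h.2.2]
    · simp [Finset.sum_sub_distrib, e_sub]
  simpa using h1.add (e_nonneg p)

lemma pos_of_le {x : Table R C} {p r : Fin R × Fin C} (h : e p + e r ≤ x) : 0 < x p := by
  have h1 := h p
  have h2 := e_nonneg r p
  simp only [Pi.add_apply, e_self, Pi.zero_apply] at h1 h2
  omega

lemma shareBlock (hB : Good ρ κ Nhat B) {x y : Table R C} (ih : IH ρ κ Nhat B (∑ p, x p))
    (h : SF (Tt ρ κ Nhat) x y) {p r : Fin R × Fin C} (hx : 0 < x p) (hy : 0 < y r)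
    (hr : ρ p.1 = ρ r.1) (hc : κ p.2 = κ r.2) : Conn B x y := by
  obtain ⟨i, j⟩ := p
  obtain ⟨i', j'⟩ := r
  simp only at hr hc
  obtain ⟨y', c1, s1, p1⟩ : ∃ y', Conn B y y' ∧ SF (Tt ρ κ Nhat) y y' ∧ 0 < y' (i, j') := by
    obtain ⟨j2, hj2⟩ := h.exRow hx
    by_cases h1 : i = i'
    · subst h1; exact ⟨y, .refl, ⟨h.2.1, h.2.1, rfl⟩, hy⟩
    by_cases h2 : j' = j2
    · subst h2; exact ⟨y, .refl, ⟨h.2.1, h.2.1, rfl⟩, hj2⟩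
    obtain ⟨y', a1, a2, a3⟩ := apply_move hB (u := e (i', j') + e (i, j2))
      (u' := e (i, j') + e (i', j2)) h.2.1
      (add_e_le (e_le h.2.1 hy) (by rw [e_ne]; exact hj2; simp [Ne.symm h1]))
      (add_nonneg (e_nonneg _) (e_nonneg _)) (hB.I i i' j' j2 h1 h2 (by
        intro q; simp only [Tt, mem_filter, mem_univ, true_and, hr]))
    exact ⟨y', a1, a2, pos_of_le a3⟩
  obtain ⟨y'', c2, s2, p2⟩ : ∃ y'', Conn B y' y'' ∧ SF (Tt ρ κ Nhat) y' y'' ∧ 0 < y'' (i, j) := by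
    have h' := h.trans s1
    obtain ⟨i2, hi2⟩ := h'.exCol hx
    by_cases h1 : j = j'
    · subst h1; exact ⟨y', .refl, ⟨h'.2.1, h'.2.1, rfl⟩, p1⟩
    by_cases h2 : i = i2
    · subst h2; exact ⟨y', .refl, ⟨h'.2.1, h'.2.1, rfl⟩, hi2⟩
    obtain ⟨y'', a1, a2, a3⟩ := apply_move hB (u := e (i2, j) + e (i, j'))
      (u' := e (i, j) + e (i2, j')) h'.2.1
      (add_e_le (e_le h'.2.1 hi2) (by rw [e_ne]; exact p1; simp [Ne.symm h2]))
      (add_nonneg (e_nonneg _) (e_nonneg _)) (hB.I i i2 j j' h2 h1 (by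
        intro q; simp only [Tt, mem_filter, mem_univ, true_and, hc]; ring))
    exact ⟨y'', a1, a2, pos_of_le a3⟩
  exact (share ih ((h.trans s1).trans s2) hx p2).trans (Conn.symm' hB.neg (c1.trans c2))

lemma finish (hB : Good ρ κ Nhat B) {x y : Table R C} (ih : IH ρ κ Nhat B (∑ p, x p))
    (h : SF (Tt ρ κ Nhat) x y) {u u' : Table R C} (hu : u ≤ x)
    (hu' : 0 ≤ u') (hz : u' - u ∈ B) {p r : Fin R × Fin C} (hp : 0 < u' p) (hy : 0 < y r)
    (hr : ρ p.1 = ρ r.1) (hc : κ p.2 = κ r.2) : Conn B x y := by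
  obtain ⟨x', a1, a2, a3⟩ := apply_move hB h.1 hu hu' hz
  refine a1.trans (shareBlock hB ?_ (a2.symm.trans h) (lt_of_lt_of_le hp (a3 p)) hy hr hc)
  rwa [← a2.tot]

/-- `x` has a cell in block `(a,b)`. -/
def Has (ρ : Fin R → ℕ) (κ : Fin C → ℕ) (x : Table R C) (a b : ℕ) : Prop :=
  ∃ i j, 0 < x (i, j) ∧ ρ i = a ∧ κ j = b

lemma hasRow {x y : Table R C} (h : SF (Tt ρ κ Nhat) x y) {a b} (hx : Has ρ κ x a b) :
    ∃ b', Has ρ κ y a b' := by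
  obtain ⟨i, j, h1, h2, h3⟩ := hx
  obtain ⟨j', hj⟩ := h.exRow h1
  exact ⟨_, i, j', hj, h2, rfl⟩

lemma hasCol {x y : Table R C} (h : SF (Tt ρ κ Nhat) x y) {a b} (hx : Has ρ κ x a b) :
    ∃ a', Has ρ κ y a' b := by
  obtain ⟨i, j, h1, h2, h3⟩ := hx
  obtain ⟨i', hi⟩ := h.exCol h1
  exact ⟨_, i', j, hi, rfl, h3⟩

/-- Step 2, swap -/
lemma swap_special (hB : Good ρ κ Nhat B) {x y : Table R C} (ih : IH ρ κ Nhat B (∑ p, x p))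
    (h : SF (Tt ρ κ Nhat) x y) (hn : ¬ Conn B x y)
    (hxs : ∀ a q, a ∈ Nhat q → ¬ Has ρ κ x a a)
    (hys : ∀ a q, a ∈ Nhat q → ¬ Has ρ κ y a a)
    {a b a' b'} (hx : Has ρ κ x a b) (h1 : Has ρ κ y a b') (h2 : Has ρ κ y a' b) :
    a' = b' ∧ ∃ q, a' ∈ Nhat q := by
  by_contra hc
  apply hn
  obtain ⟨i0, j0, p0, r0, c0⟩ := id hx
  obtain ⟨i, j', p1, r1, c1⟩ := id h1
  obtain ⟨i', j, p2, r2, c2⟩ := id h2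
  by_cases hi : i = i'
  · subst hi
    exact shareBlock hB ih h p0 p2 (by simp; omega) (by simp; omega)
  by_cases hj : j = j'
  · subst hj
    exact shareBlock hB ih h p0 p1 (by simp; omega) (by simp; omega)
  refine (finish hB (by rwa [← h.tot]) h.symm (u := e (i', j) + e (i, j'))
    (u' := e (i, j) + e (i', j')) ?_ (add_nonneg (e_nonneg _) (e_nonneg _))
    (hB.I i i' j j' hi hj ?_) (p := (i,j)) ?_ p0 ?_ ?_).symm' hB.neg
  · exact add_e_le (e_le h.2.1 p2) (by rw [e_ne]; exact p1; simp [Ne.symm hi])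
  · intro q
    have n1 : (i, j) ∉ Tt ρ κ Nhat q := by
      simp only [Tt, mem_filter, mem_univ, true_and]
      rintro ⟨t1, t2⟩
      exact hxs a q (r1 ▸ t2) (by rw [r1, c2] at t1; rwa [← t1] at hx)
    have n2 : (i', j) ∉ Tt ρ κ Nhat q := by
      simp only [Tt, mem_filter, mem_univ, true_and]
      rintro ⟨t1, t2⟩
      exact hys a' q (r2 ▸ t2) (by rw [r2, c2] at t1; rwa [← t1] at h2)
    have n3 : (i, j') ∉ Tt ρ κ Nhat q := by
      simp only [Tt, mem_filter, mem_univ, true_and]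
      rintro ⟨t1, t2⟩
      exact hys a q (r1 ▸ t2) (by rw [r1, c1] at t1; rwa [← t1] at h1)
    have n4 : (i', j') ∉ Tt ρ κ Nhat q := by
      simp only [Tt, mem_filter, mem_univ, true_and]
      rintro ⟨t1, t2⟩
      exact hc ⟨by omega, q, r2 ▸ t2⟩
    simp [n1, n2, n3, n4]
  · have := e_nonneg (i', j') (i, j)
    simp only [Pi.add_apply, e_self, Pi.zero_apply] at this ⊢
    omega
  · simp; omega
  · simp; omega

lemma step2 (hB : Good ρ κ Nhat B) {x y : Table R C} (ih : IH ρ κ Nhat B (∑ p, x p))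
    (h : SF (Tt ρ κ Nhat) x y)
    (hxs : ∀ a q, a ∈ Nhat q → ¬ Has ρ κ x a a)
    (hys : ∀ a q, a ∈ Nhat q → ¬ Has ρ κ y a a)
    {a b} (hab : Has ρ κ x a b) : Conn B x y := by
  by_contra hn
  have hn' : ¬ Conn B y x := fun hc => hn (hc.symm' hB.neg)
  have ih' : IH ρ κ Nhat B (∑ p, y p) := by rwa [← h.tot]
  have X : ∀ {a b a' b'}, Has ρ κ x a b → Has ρ κ y a b' → Has ρ κ y a' b →
      a' = b' ∧ ∃ q, a' ∈ Nhat q := fun h1 h2 h3 => swap_special hB ih h hn hxs hys h1 h2 h3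
  have Y : ∀ {a b a' b'}, Has ρ κ y a b → Has ρ κ x a b' → Has ρ κ x a' b →
      a' = b' ∧ ∃ q, a' ∈ Nhat q :=
    fun h1 h2 h3 => swap_special hB ih' h.symm hn' hys hxs h1 h2 h3
  obtain ⟨c, hac⟩ := hasRow h hab
  obtain ⟨c', hcb⟩ := hasCol h hab
  obtain ⟨rfl, qc, hqc⟩ := X hab hac hcb
  obtain ⟨b', hbc⟩ := hasCol h.symm hac
  obtain ⟨rfl, qb, hqb⟩ := Y hac hab hbc
  obtain ⟨a', hca⟩ := hasRow h.symm hcb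
  obtain ⟨rfl, qa, hqa⟩ := Y hcb hca hab
  have nab : a ≠ b' := fun hh => hxs a qa hqa (by rwa [← hh] at hab)
  have nbc : b' ≠ c' := fun hh => hxs b' qb hqb (by rwa [← hh] at hbc)
  have nca : c' ≠ a := fun hh => hxs c' qc hqc (by rwa [← hh] at hca)
  obtain ⟨i₁, j₂, p1, r1, c1⟩ := hab
  obtain ⟨i₂, j₃, p2, r2, c2⟩ := hbc
  obtain ⟨i₃, j₁, p3, r3, c3⟩ := hca
  obtain ⟨i0, j0, p0, r0, c0⟩ := hac
  have m := hB.neg _ (hB.II i₁ i₂ i₃ j₁ j₂ j₃ (by omega) (by omega) (by omega) (by omega)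
    (by omega) (by omega))
  apply hn
  have n12 : i₁ ≠ i₂ := by rintro rfl; omega
  have n13 : i₁ ≠ i₃ := by rintro rfl; omega
  have n23 : i₂ ≠ i₃ := by rintro rfl; omega
  refine finish hB ih h (u := e (i₁,j₂) + e (i₂,j₃) + e (i₃,j₁))
    (u' := e (i₁,j₃) + e (i₂,j₁) + e (i₃,j₂)) ?_
    (add_nonneg (add_nonneg (e_nonneg _) (e_nonneg _)) (e_nonneg _)) ?_
    (p := (i₁, j₃)) ?_ p0 (by simp; omega) (by simp; omega)
  · refine add_e_le (add_e_le (e_le h.1 p1) ?_) ?_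
    · rw [e_ne (by simp [n12])]; exact p2
    · rw [Pi.add_apply, e_ne (by simp [n13]), e_ne (by simp [n23])]; exact p3
  · convert m using 1; abel
  · simp [e, n12, n13]

lemma step1 (hB : Good ρ κ Nhat B)
    {x y : Table R C} (ih : IH ρ κ Nhat B (∑ p, x p))
    (h : SF (Tt ρ κ Nhat) x y) {k q} (hk : k ∈ Nhat q) (hkk : Has ρ κ x k k) :
    Conn B x y := by
  by_contra hn
  have ih' : IH ρ κ Nhat B (∑ p, y p) := by rwa [← h.tot]
  have hn' : ¬ Conn B y x := fun hc => hn (hc.symm' hB.neg)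
  have D : ∀ {a b}, Has ρ κ x a b → ¬ Has ρ κ y a b := by
    rintro a b ⟨i, j, p, r, c⟩ ⟨i', j', p', r', c'⟩
    exact hn (shareBlock hB ih h p p' (by simp; omega) (by simp; omega))
  obtain ⟨l, hl, hll⟩ : ∃ l ∈ Nhat q, Has ρ κ y l l := by
    obtain ⟨i, j, p, r, c⟩ := hkk
    obtain ⟨⟨i', j'⟩, hm, hp⟩ := exists_pos (fun p _ => h.1 p) (i := (i, j))
      (by simp [Tt, r, c, hk]) p (h.sub q)
    simp only [Tt, mem_filter, mem_univ, true_and] at hm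
    exact ⟨ρ i', hm.2, i', j', hp, rfl, hm.1.symm⟩
  have hkl : k ≠ l := by rintro rfl; exact D hkk hll
  obtain ⟨i₁, j₁, p1, r1, c1⟩ := id hkk
  obtain ⟨i₂, j₂, p2, r2, c2⟩ := id hll
  -- type III on y
  have Y3 : ∀ {α β}, Has ρ κ y k β → Has ρ κ y α k → β = l ∨ α = l := by
    intro α β hb ha
    by_contra! hc
    have b1 : β ≠ k := by rintro rfl; exact D hkk hb
    have a1 : α ≠ k := by rintro rfl; exact D hkk ha
    obtain ⟨i, j₃, p3, r3, c3⟩ := hb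
    obtain ⟨i₃, j, p4, r4, c4⟩ := ha
    have m := hB.III i i₂ i₃ j j₂ j₃ k l q hk hl hkl r3 c4 r2 c2 (by omega) (by omega)
      (by omega) (by omega)
    have n12 : i ≠ i₂ := by rintro rfl; omega
    have n13 : i ≠ i₃ := by rintro rfl; omega
    have n23 : i₂ ≠ i₃ := by rintro rfl; omega
    apply hn'
    refine finish hB ih' h.symm (u := e (i,j₃) + e (i₂,j₂) + e (i₃,j))
      (u' := e (i,j) + e (i₂,j₃) + e (i₃,j₂)) ?_
      (add_nonneg (add_nonneg (e_nonneg _) (e_nonneg _)) (e_nonneg _)) ?_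
      (p := (i, j)) ?_ p1 (by simp; omega) (by simp; omega)
    · refine add_e_le (add_e_le (e_le h.2.1 p3) ?_) ?_
      · rw [e_ne (by simp [n12])]; exact p2
      · rw [Pi.add_apply, e_ne (by simp [n13]), e_ne (by simp [n23])]; exact p4
    · convert m using 1; abel
    · simp [e, n12, n13]
  have X3 : ∀ {α β}, Has ρ κ x l β → Has ρ κ x α l → β = k ∨ α = k := by
    intro α β hb ha
    by_contra! hc
    have b1 : β ≠ l := by rintro rfl; exact D hb hll
    have a1 : α ≠ l := by rintro rfl; exact D ha hll
    obtain ⟨i, j₃, p3, r3, c3⟩ := hb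
    obtain ⟨i₃, j, p4, r4, c4⟩ := ha
    have m := hB.III i i₁ i₃ j j₁ j₃ l k q hl hk hkl.symm r3 c4 r1 c1 (by omega) (by omega)
      (by omega) (by omega)
    have n12 : i ≠ i₁ := by rintro rfl; omega
    have n13 : i ≠ i₃ := by rintro rfl; omega
    have n23 : i₁ ≠ i₃ := by rintro rfl; omega
    apply hn
    refine finish hB ih h (u := e (i,j₃) + e (i₁,j₁) + e (i₃,j))
      (u' := e (i,j) + e (i₁,j₃) + e (i₃,j₁)) ?_
      (add_nonneg (add_nonneg (e_nonneg _) (e_nonneg _)) (e_nonneg _)) ?_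
      (p := (i, j)) ?_ p2 (by simp; omega) (by simp; omega)
    · refine add_e_le (add_e_le (e_le h.1 p3) ?_) ?_
      · rw [e_ne (by simp [n12])]; exact p1
      · rw [Pi.add_apply, e_ne (by simp [n13]), e_ne (by simp [n23])]; exact p4
    · convert m using 1; abel
    · simp [e, n12, n13]
  obtain ⟨β, hyβ⟩ := hasRow h hkk
  obtain ⟨α, hyα⟩ := hasCol h hkk
  obtain ⟨γ, hxγ⟩ := hasRow h.symm hll
  obtain ⟨δ, hxδ⟩ := hasCol h.symm hll
  have key : (Has ρ κ y k l ∧ Has ρ κ x l k) ∨ (Has ρ κ y l k ∧ Has ρ κ x k l) := by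
    rcases Y3 hyβ hyα with rfl | rfl <;> rcases X3 hxγ hxδ with rfl | rfl
    · exact .inl ⟨hyβ, hxγ⟩
    · exact absurd hyβ (D hxδ)
    · exact absurd hyα (D hxγ)
    · exact .inr ⟨hyα, hxδ⟩
  rcases key with ⟨hy, hx⟩ | ⟨hy, hx⟩
  · obtain ⟨i, j, p, r, c⟩ := id hy
    obtain ⟨i', j', p', r', c'⟩ := id hx
    have two : 2 ≤ ∑ p ∈ univ.filter (fun p : Fin R × Fin C => κ p.2 = l), x p := by
      rw [h.colTypes (fun j => κ j = l)]
      have hle : e (i, j) + e (i₂, j₂) ≤ y := add_e_le (e_le h.2.1 p)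
        (by rw [e_ne]; exact p2; simp; rintro rfl; omega)
      have := Finset.sum_le_sum
        (s := univ.filter (fun p : Fin R × Fin C => κ p.2 = l)) (fun r _ => hle r)
      simpa [Finset.sum_add_distrib, e_sub, c, c2] using this
    obtain ⟨⟨i₃, j₃⟩, m3, ⟨i₄, j₄⟩, m4, q3, q4, hle⟩ := exists_two h.1 _ two
    simp only [mem_filter, mem_univ, true_and] at m3 m4
    have a3 : ρ i₃ ≠ k := fun hh => D ⟨i₃, j₃, q3, hh, m3⟩ hy
    have a4 : ρ i₄ ≠ k := fun hh => D ⟨i₄, j₄, q4, hh, m4⟩ hy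
    have b3 : ρ i₃ ≠ l := fun hh => D ⟨i₃, j₃, q3, hh, m3⟩ hll
    have b4 : ρ i₄ ≠ l := fun hh => D ⟨i₄, j₄, q4, hh, m4⟩ hll
    have m := hB.neg _ (hB.IVc i₁ i' i₃ i₄ j₁ j' j₃ j₄ k l q hk hl hkl c1 c' r1 m3 m4 r'
      a3 b3 a4 b4)
    have n1 : i₃ ≠ i₁ := by rintro rfl; omega
    have n2 : i₄ ≠ i₁ := by rintro rfl; omega
    have n3 : i₃ ≠ i' := by rintro rfl; omega
    have n4 : i₄ ≠ i' := by rintro rfl; omega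
    have n5 : i₁ ≠ i' := by rintro rfl; omega
    apply hn
    refine finish hB ih h (u := e (i₃,j₃) + e (i₄,j₄) + e (i₁,j₁) + e (i',j'))
      (u' := e (i',j₃) + e (i₁,j₄) + e (i₃,j₁) + e (i₄,j')) ?_
      (add_nonneg (add_nonneg (add_nonneg (e_nonneg _) (e_nonneg _)) (e_nonneg _)) (e_nonneg _)) ?_
      (p := (i', j₃)) ?_ p2 (by simp; omega) (by simp; omega)
    · refine add_e_le (add_e_le hle ?_) ?_
      · rw [Pi.add_apply, e_ne (by simp [n1]), e_ne (by simp [n2])]; exact p1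
      · rw [Pi.add_apply, Pi.add_apply, e_ne (by simp [n3]), e_ne (by simp [n4]),
          e_ne (by simp [n5])]; exact p'
    · convert m using 1; abel
    · simp [e, n5.symm, n3.symm, n4.symm]
  · obtain ⟨i, j, p, r, c⟩ := id hy
    obtain ⟨i', j', p', r', c'⟩ := id hx
    have two : 2 ≤ ∑ p ∈ univ.filter (fun p : Fin R × Fin C => ρ p.1 = l), x p := by
      rw [h.rowTypes (fun j => ρ j = l)]
      have hle : e (i, j) + e (i₂, j₂) ≤ y := add_e_le (e_le h.2.1 p)
        (by rw [e_ne]; exact p2; simp; rintro _ rfl; omega)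
      have := Finset.sum_le_sum
        (s := univ.filter (fun p : Fin R × Fin C => ρ p.1 = l)) (fun r _ => hle r)
      simpa [Finset.sum_add_distrib, e_sub, r, r2] using this
    obtain ⟨⟨i₃, j₃⟩, m3, ⟨i₄, j₄⟩, m4, q3, q4, hle⟩ := exists_two h.1 _ two
    simp only [mem_filter, mem_univ, true_and] at m3 m4
    have a3 : κ j₃ ≠ k := fun hh => D ⟨i₃, j₃, q3, m3, hh⟩ hy
    have a4 : κ j₄ ≠ k := fun hh => D ⟨i₄, j₄, q4, m4, hh⟩ hy
    have b3 : κ j₃ ≠ l := fun hh => D ⟨i₃, j₃, q3, m3, hh⟩ hll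
    have b4 : κ j₄ ≠ l := fun hh => D ⟨i₄, j₄, q4, m4, hh⟩ hll
    have m := hB.neg _ (hB.IVr i₁ i' i₃ i₄ j₁ j' j₃ j₄ k l q hk hl hkl r1 r' c1 m3 m4 c'
      a3 b3 a4 b4)
    have n1 : j₃ ≠ j₁ := by rintro rfl; omega
    have n2 : j₄ ≠ j₁ := by rintro rfl; omega
    have n3 : j₃ ≠ j' := by rintro rfl; omega
    have n4 : j₄ ≠ j' := by rintro rfl; omega
    have n5 : j₁ ≠ j' := by rintro rfl; omega
    apply hn
    refine finish hB ih h (u := e (i₃,j₃) + e (i₄,j₄) + e (i₁,j₁) + e (i',j'))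
      (u' := e (i₃,j') + e (i₄,j₁) + e (i₁,j₃) + e (i',j₄)) ?_
      (add_nonneg (add_nonneg (add_nonneg (e_nonneg _) (e_nonneg _)) (e_nonneg _)) (e_nonneg _)) ?_
      (p := (i₃, j')) ?_ p2 (by simp; omega) (by simp; omega)
    · refine add_e_le (add_e_le hle ?_) ?_
      · rw [Pi.add_apply, e_ne (by simp [n1]), e_ne (by simp [n2])]; exact p1
      · rw [Pi.add_apply, Pi.add_apply, e_ne (by simp [n3]), e_ne (by simp [n4]),
          e_ne (by simp [n5])]; exact p'
    · convert m using 1; abel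
    · simp [e, n5.symm, n3.symm, n4.symm]

lemma conn_all (hB : Good ρ κ Nhat B) (n : ℕ) :
    ∀ x y : Table R C, SF (Tt ρ κ Nhat) x y → ∑ p, x p = n → Conn B x y := by
  induction n using Nat.strong_induction_on with
  | _ n ihn =>
    intro x y h hx
    have ih : IH ρ κ Nhat B (∑ p, x p) := by
      intro x' y' h' hlt
      have h0 : 0 ≤ ∑ p, x' p := Finset.sum_nonneg fun p _ => h'.1 p
      exact ihn (∑ p, x' p).toNat (by omega) x' y' h' (by omega)
    have ih' : IH ρ κ Nhat B (∑ p, y p) := by rwa [← h.tot]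
    by_cases h1 : ∃ k q, k ∈ Nhat q ∧ Has ρ κ x k k
    · obtain ⟨k, q, hk, hkk⟩ := h1
      exact step1 hB ih h hk hkk
    by_cases h2 : ∃ k q, k ∈ Nhat q ∧ Has ρ κ y k k
    · obtain ⟨k, q, hk, hkk⟩ := h2
      exact (step1 hB ih' h.symm hk hkk).symm' hB.neg
    by_cases h3 : ∃ a b, Has ρ κ x a b
    · obtain ⟨a, b, hab⟩ := h3
      exact step2 hB ih h (fun a q ha hh => h1 ⟨a, q, ha, hh⟩)
        (fun a q ha hh => h2 ⟨a, q, ha, hh⟩) hab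
    have hx0 : x = 0 := by
      funext ⟨i, j⟩
      by_contra hc
      exact h3 ⟨_, _, i, j, lt_of_le_of_ne (h.1 (i, j)) (Ne.symm hc), rfl, rfl⟩
    have hy0 : y = 0 := by
      funext ⟨i, j⟩
      by_contra hc
      obtain ⟨j', hj'⟩ := h.symm.exRow (lt_of_le_of_ne (h.2.1 (i, j)) (Ne.symm hc))
      exact h3 ⟨_, _, i, j', hj', rfl, rfl⟩
    rw [hx0, hy0]
    exact .refl

lemma exists_path {x y : Table R C} (h : Conn B x y) :
    ∃ (n : ℕ) (f : ℕ → Table R C), f 0 = x ∧ f n = y ∧ ∀ k < n, Step B (f k) (f (k+1)) := by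
  induction h using Relation.ReflTransGen.head_induction_on with
  | refl => exact ⟨0, fun _ => y, rfl, rfl, by simp⟩
  | head hs _ ih =>
    rename_i a b _
    obtain ⟨n, f, h0, h1, h2⟩ := ih
    refine ⟨n + 1, fun k => Nat.casesOn k a f, rfl, h1, ?_⟩
    rintro (_ | k) hk
    · simpa [h0] using hs
    · exact h2 k (by omega)

lemma sum_tele (f : ℕ → Table R C) (n : ℕ) :
    ∑ k ∈ range n, (f (k+1) - f k) = f n - f 0 := Finset.sum_range_sub f n

lemma sum_Iic (g : ℕ → Table R C) {U : ℕ} (u : Fin U) :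
    ∑ s ∈ Finset.Iic u, g s = ∑ k ∈ range (u + 1), g k := by
  refine Finset.sum_bij (fun s _ => s.1) ?_ ?_ ?_ ?_
  · intro s hs
    have := Finset.mem_Iic.1 hs
    simp only [Finset.mem_range]
    have : s.1 ≤ u.1 := this
    omega
  · intro a _ b _ hab; exact Fin.ext hab
  · intro b hb
    have := Finset.mem_range.1 hb
    exact ⟨⟨b, by omega⟩, Finset.mem_Iic.2 (by show b ≤ u.1; omega), rfl⟩
  · intros; rfl

theorem markov (hB : Good ρ κ Nhat B) (hfin : B.Finite) : IsMarkovBasis (Tt ρ κ Nhat) B := by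
  refine ⟨hfin, hB.move, hB.neg, ?_⟩
  intro t x hx y hy hne
  have hsf : SF (Tt ρ κ Nhat) x y := ⟨hx.1, hy.1, hx.2.trans hy.2.symm⟩
  have h0 : 0 ≤ ∑ p, x p := Finset.sum_nonneg fun p _ => hx.1 p
  have hc := conn_all hB (∑ p, x p).toNat x y hsf (by omega)
  obtain ⟨n, f, f0, fn, hs⟩ := exists_path hc
  have hcfg : ∀ k ≤ n, f k ∈ Fiber (Tt ρ κ Nhat) t := by
    intro k
    induction k with
    | zero => intro _; rw [f0]; exact hx
    | succ k ihk =>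
      intro hk
      have h1 := ihk (by omega)
      have h2 := hs k (by omega)
      refine ⟨h2.2.1, ?_⟩
      have h3 := hB.move _ h2.2.2
      unfold IsMove at h3
      rw [configMap_sub, sub_eq_zero] at h3
      rw [h3]; exact h1.2
  refine ⟨n, ?_, fun u => f (u + 1) - f u, ?_, ?_, ?_⟩
  · rcases Nat.eq_zero_or_pos n with rfl | h
    · exact absurd (f0.symm.trans fn) hne
    · exact h
  · intro u; exact (hs u u.2).2.2
  · rw [Fin.sum_univ_eq_sum_range (fun k => f (k + 1) - f k), sum_tele, f0, fn]; abel
  · intro u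
    rw [sum_Iic (fun k => f (k + 1) - f k), sum_tele, f0, add_sub_cancel]
    exact hcfg _ u.2

end Main

lemma typeFn (M N : ℕ) (rr : ℕ → ℕ) (h1 : rr 1 = 1)
    (hmono : ∀ n, 1 ≤ n → n ≤ N → rr n < rr (n + 1))
    (hle : rr (N + 1) ≤ M + 1) (htop : rr (N + 2) = M + 1) :
    ∃ ρ : Fin M → ℕ, ∀ i, 1 ≤ ρ i ∧ ρ i ≤ N + 1 ∧
      ∀ k, 1 ≤ k → k ≤ N + 1 → (ρ i = k ↔ rr k ≤ i.1 + 1 ∧ i.1 + 1 < rr (k + 1)) := by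
  have hm : ∀ n, 1 ≤ n → n ≤ N + 1 → rr n ≤ rr (n + 1) := by
    intro n a b
    rcases Nat.lt_or_ge N n with h | h
    · have : n = N + 1 := by omega
      subst this
      rw [htop]; exact hle
    · exact (hmono n a h).le
  have mono : ∀ d a, 1 ≤ a → a + d ≤ N + 2 → rr a ≤ rr (a + d) := by
    intro d
    induction d with
    | zero => intro a _ _; exact le_rfl
    | succ d ih =>
      intro a ha hd
      exact (ih a ha (by omega)).trans (hm (a + d) (by omega) (by omega))
  have ex : ∀ m v, 1 ≤ v → v < rr (m + 1) → ∃ k, 1 ≤ k ∧ k ≤ m ∧ rr k ≤ v ∧ v < rr (k + 1) := by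
    intro m
    induction m with
    | zero => intro v a b; simp only [zero_add, h1] at b; omega
    | succ m ih =>
      intro v a b
      by_cases hv : v < rr (m + 1)
      · obtain ⟨k, c1, c2, c3⟩ := ih v a hv
        exact ⟨k, c1, by omega, c3⟩
      · exact ⟨m + 1, by omega, le_rfl, by omega, b⟩
  have ex' : ∀ i : Fin M, ∃ k, 1 ≤ k ∧ k ≤ N + 1 ∧ rr k ≤ i.1 + 1 ∧ i.1 + 1 < rr (k + 1) :=
    fun i => ex (N + 1) (i.1 + 1) (by omega) (by
      have := i.2
      show i.1 + 1 < rr (N + 2)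
      omega)
  choose ρ hρ using ex'
  refine ⟨ρ, fun i => ⟨(hρ i).1, (hρ i).2.1, fun k hk hk' => ?_⟩⟩
  obtain ⟨a1, a2, a3, a4⟩ := hρ i
  constructor
  · rintro rfl; exact ⟨a3, a4⟩
  · rintro ⟨b1, b2⟩
    rcases lt_trichotomy (ρ i) k with h | h | h
    · have := mono (k - (ρ i + 1)) (ρ i + 1) (by omega) (by omega)
      rw [show ρ i + 1 + (k - (ρ i + 1)) = k by omega] at this
      omega
    · exact h
    · have := mono (ρ i - (k + 1)) (k + 1) (by omega) (by omega)
      rw [show k + 1 + (ρ i - (k + 1)) = ρ i by omega] at this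
      omega

lemma typeIVrow_neg {Nd Nb : ℕ} {rr cc : ℕ → ℕ} {z : Table R C}
    (h : IsTypeIVrow Nd Nb rr cc z) : IsTypeIVrow Nd Nb rr cc (-z) := by
  obtain ⟨i₁, i₂, i₃, i₄, j₁, j₂, j₃, j₄, rfl, ⟨k, l, k1, k2, l1, l2, kl, m1, m2⟩, hS, s1, s2⟩ := h
  refine ⟨i₃, i₄, i₁, i₂, j₂, j₁, j₃, j₄, by abel,
    ⟨l, k, l1, l2, k1, k2, kl.symm, m2, m1⟩, ?_, s2, s1⟩
  intro p hp
  apply hS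
  simp only [List.mem_cons, List.not_mem_nil, or_false] at hp ⊢
  tauto

lemma typeIVrow_bd {Nd Nb : ℕ} {rr cc : ℕ → ℕ} {z : Table R C}
    (h : IsTypeIVrow Nd Nb rr cc z) (p) : -4 ≤ z p ∧ z p ≤ 4 := by
  obtain ⟨i₁, i₂, i₃, i₄, j₁, j₂, j₃, j₄, rfl, -⟩ := h
  have a := fun r : Fin R × Fin C => e_nonneg r p
  have b := fun r : Fin R × Fin C => e_le_one r p
  simp only [Pi.add_apply, Pi.sub_apply, Pi.zero_apply] at a ⊢
  constructor
  · linarith [a (i₁,j₁), a (i₂,j₂), a (i₃,j₃), a (i₄,j₄), b (i₁,j₃), b (i₂,j₄), b (i₃,j₂), b (i₄,j₁)]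
  · linarith [b (i₁,j₁), b (i₂,j₂), b (i₃,j₃), b (i₄,j₄), a (i₁,j₃), a (i₂,j₄), a (i₃,j₂), a (i₄,j₁)]

lemma types_bd {Nd Nb : ℕ} {rr cc : ℕ → ℕ} {z : Table R C}
    (h : IsBasicMove z ∨ IsTypeII Nd Nb rr cc z ∨ IsTypeIII Nd Nb rr cc z ∨
      IsTypeIV Nd Nb rr cc z) (p) : -4 ≤ z p ∧ z p ≤ 4 := by
  have a := fun r : Fin R × Fin C => e_nonneg r p
  have b := fun r : Fin R × Fin C => e_le_one r p
  simp only [Pi.zero_apply] at a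
  rcases h with ⟨i, i', j, j', -, -, rfl⟩ | ⟨i₁, i₂, i₃, j₁, j₂, j₃, rfl, -⟩ |
    ⟨i₁, i₂, i₃, j₁, j₂, j₃, rfl, -⟩ | h | h
  · simp only [Pi.add_apply, Pi.sub_apply]
    constructor
    · linarith [a (i, j), a (i', j'), b (i', j), b (i, j')]
    · linarith [b (i, j), b (i', j'), a (i', j), a (i, j')]
  · simp only [Pi.add_apply, Pi.sub_apply]
    constructor
    · linarith [a (i₁,j₂), a (i₂,j₃), a (i₃,j₁), b (i₁,j₃), b (i₂,j₁), b (i₃,j₂)]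
    · linarith [b (i₁,j₂), b (i₂,j₃), b (i₃,j₁), a (i₁,j₃), a (i₂,j₁), a (i₃,j₂)]
  · simp only [Pi.add_apply, Pi.sub_apply]
    constructor
    · linarith [a (i₁,j₁), a (i₂,j₃), a (i₃,j₂), b (i₁,j₃), b (i₂,j₂), b (i₃,j₁)]
    · linarith [b (i₁,j₁), b (i₂,j₃), b (i₃,j₂), a (i₁,j₃), a (i₂,j₂), a (i₃,j₁)]
  · exact typeIVrow_bd h p
  · exact typeIVrow_bd h (p.2, p.1)

lemma types_neg {Nd Nb : ℕ} {rr cc : ℕ → ℕ} {z : Table R C}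
    (h : IsBasicMove z ∨ IsTypeII Nd Nb rr cc z ∨ IsTypeIII Nd Nb rr cc z ∨
      IsTypeIV Nd Nb rr cc z) :
    IsBasicMove (-z) ∨ IsTypeII Nd Nb rr cc (-z) ∨ IsTypeIII Nd Nb rr cc (-z) ∨
      IsTypeIV Nd Nb rr cc (-z) := by
  have comm : ∀ p r : Fin R × Fin C, SameBlock Nb rr cc p r → SameBlock Nb rr cc r p := by
    rintro p r ⟨k, l, a, b, c, d, f, g⟩
    exact ⟨k, l, a, b, c, d, g, f⟩
  rcases h with ⟨i, i', j, j', hi, hj, rfl⟩ | ⟨i₁, i₂, i₃, j₁, j₂, j₃, rfl, hS, hP⟩ |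
    ⟨i₁, i₂, i₃, j₁, j₂, j₃, rfl, ⟨k, l, k1, k2, l1, l2, kl, m1, m2⟩, hS, hP⟩ | h | h
  · exact .inl ⟨i', i, j, j', hi.symm, hj, by abel⟩
  · refine .inr (.inl ⟨i₁, i₃, i₂, j₁, j₃, j₂, by abel, ?_, ?_⟩)
    · intro p hp
      apply hS
      simp only [List.mem_cons, List.not_mem_nil, or_false] at hp ⊢
      tauto
    · refine (List.Perm.pairwise_iff (fun h h' => h (comm _ _ h')) ?_).1 hP
      grind
  · refine .inr (.inr (.inl ⟨i₂, i₁, i₃, j₂, j₁, j₃, by abel,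
      ⟨l, k, l1, l2, k1, k2, kl.symm, m2, m1⟩, ?_, ?_⟩))
    · intro p hp
      apply hS
      simp only [List.mem_cons, List.not_mem_nil, or_false] at hp ⊢
      tauto
    · refine (List.Perm.pairwise_iff (fun h h' => h (comm _ _ h')) ?_).1 hP
      grind
  · exact .inr (.inr (.inr (.inl (typeIVrow_neg h))))
  · exact .inr (.inr (.inr (.inr (typeIVrow_neg h))))

lemma e_swap (a : Fin R) (b : Fin C) (p : Fin C × Fin R) :
    e (a, b) (p.2, p.1) = e (b, a) p := by
  obtain ⟨c, d⟩ := p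
  simp only [e, Prod.mk.injEq, and_comm]

end Proof

/-- in the general block diagonal effect model, the moves of Types
I–IV in `M_{T_1,…,T_Q}` form a Markov basis for the configuration `A_{T_1,…,T_Q}`. -/
theorem generalBlockDiagonal_markovBasis (R C N Q : ℕ)
    (rr cc : ℕ → ℕ) (hr1 : rr 1 = 1) (hc1 : cc 1 = 1)
    (hrmono : ∀ n, 1 ≤ n → n ≤ N → rr n < rr (n + 1))
    (hcmono : ∀ n, 1 ≤ n → n ≤ N → cc n < cc (n + 1))
    (hrle : rr (N + 1) ≤ R + 1) (hcle : cc (N + 1) ≤ C + 1)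
    (hrtop : rr (N + 2) = R + 1) (hctop : cc (N + 2) = C + 1)
    (Nhat : Fin Q → Finset ℕ)
    (hsub : ∀ q, Nhat q ⊆ Finset.Icc 1 N)
    (hdisj : ∀ q q', q ≠ q' → Disjoint (Nhat q) (Nhat q')) :
    IsMarkovBasis
      (fun q : Fin Q => (Nhat q).biUnion fun n => block (R := R) (C := C) rr cc n n)
      {z | (IsBasicMove z ∨ IsTypeII N (N + 1) rr cc z ∨ IsTypeIII N (N + 1) rr cc z ∨
            IsTypeIV N (N + 1) rr cc z) ∧
        IsMove (fun q : Fin Q =>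
          (Nhat q).biUnion fun n => block (R := R) (C := C) rr cc n n) z} := by
  obtain ⟨ρ, hρ⟩ := typeFn R N rr hr1 hrmono hrle hrtop
  obtain ⟨κ, hκ⟩ := typeFn C N cc hc1 hcmono hcle hctop
  have hblock : ∀ k l (p : Fin R × Fin C), 1 ≤ k → k ≤ N + 1 → 1 ≤ l → l ≤ N + 1 →
      (p ∈ block (R := R) (C := C) rr cc k l ↔ ρ p.1 = k ∧ κ p.2 = l) := by
    intro k l p a b c d
    rw [(hρ p.1).2.2 k a b, (hκ p.2).2.2 l c d]
    simp only [block, mem_filter, mem_univ, true_and, and_assoc]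
  have hblock' : ∀ k l (p : Fin C × Fin R), 1 ≤ k → k ≤ N + 1 → 1 ≤ l → l ≤ N + 1 →
      (p ∈ block (R := C) (C := R) cc rr k l ↔ κ p.1 = k ∧ ρ p.2 = l) := by
    intro k l p a b c d
    rw [(hκ p.1).2.2 k a b, (hρ p.2).2.2 l c d]
    simp only [block, mem_filter, mem_univ, true_and, and_assoc]
  have hSd : ∀ p : Fin R × Fin C, ρ p.1 ≠ κ p.2 → p ∉ Sdiag N rr cc := by
    intro p hp hm
    simp only [Sdiag, mem_biUnion, mem_Icc] at hm
    obtain ⟨k, hk, hm⟩ := hm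
    rw [hblock k k p (by omega) (by omega) (by omega) (by omega)] at hm
    omega
  have hSd' : ∀ p : Fin C × Fin R, κ p.1 ≠ ρ p.2 → p ∉ Sdiag N cc rr := by
    intro p hp hm
    simp only [Sdiag, mem_biUnion, mem_Icc] at hm
    obtain ⟨k, hk, hm⟩ := hm
    rw [hblock' k k p (by omega) (by omega) (by omega) (by omega)] at hm
    omega
  have hSB : ∀ p r : Fin R × Fin C, (ρ p.1 = ρ r.1 → κ p.2 ≠ κ r.2) →
      ¬ SameBlock (N + 1) rr cc p r := by
    rintro p r hpr ⟨k, l, a, b, c, d, f, g⟩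
    rw [hblock k l _ a b c d] at f g
    exact hpr (by omega) (by omega)
  have hSR : ∀ i i', ρ i = ρ i' → SameRowBlock (N + 1) rr i i' := by
    intro i i' h
    have h1 := ((hρ i).2.2 (ρ i) (hρ i).1 (hρ i).2.1).1 rfl
    have h2 := ((hρ i').2.2 (ρ i') (hρ i').1 (hρ i').2.1).1 rfl
    rw [← h] at h2
    exact ⟨ρ i, (hρ i).1, (hρ i).2.1, h1.1, h1.2, h2.1, h2.2⟩
  have hSR' : ∀ i i', κ i = κ i' → SameRowBlock (N + 1) cc i i' := by
    intro i i' h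
    have h1 := ((hκ i).2.2 (κ i) (hκ i).1 (hκ i).2.1).1 rfl
    have h2 := ((hκ i').2.2 (κ i') (hκ i').1 (hκ i').2.1).1 rfl
    rw [← h] at h2
    exact ⟨κ i, (hκ i).1, (hκ i).2.1, h1.1, h1.2, h2.1, h2.2⟩
  have hT : (fun q : Fin Q => (Nhat q).biUnion fun n => block (R := R) (C := C) rr cc n n) =
      Tt ρ κ Nhat := by
    funext q
    ext p
    simp only [mem_biUnion, Tt, mem_filter, mem_univ, true_and]
    constructor
    · rintro ⟨n, hn, hp⟩
      have := Finset.mem_Icc.1 (hsub q hn)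
      rw [hblock n n p (by omega) (by omega) (by omega) (by omega)] at hp
      rw [hp.1, hp.2]; exact ⟨rfl, hn⟩
    · rintro ⟨h1, h2⟩
      have := Finset.mem_Icc.1 (hsub q h2)
      refine ⟨_, h2, ?_⟩
      rw [hblock _ _ p (by omega) (by omega) (by omega) (by omega)]
      exact ⟨rfl, h1.symm⟩
  have hlab : ∀ k l q, k ∈ Nhat q → l ∈ Nhat q → ∀ q', k ∈ Nhat q' ↔ l ∈ Nhat q' := by
    intro k l q hk hl q'
    by_cases hq : q = q'
    · subst hq; simp [hk, hl]
    · have := Finset.disjoint_left.1 (hdisj q q' hq)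
      exact ⟨fun h => absurd h (this hk), fun h => absurd h (this hl)⟩
  rw [hT]
  refine markov ?_ ?_
  · constructor
    · exact fun z hz => hz.2
    · exact fun z hz => ⟨types_neg hz.1, isMove_neg _ _ hz.2⟩
    · intro i i' j j' hi hj hq
      refine ⟨.inl ⟨i, i', j, j', hi, hj, by abel⟩, ?_⟩
      rw [isMove_iff]
      simp only [Pi.add_apply, Pi.sub_apply, Finset.sum_add_distrib, Finset.sum_sub_distrib,
        e_row, e_col, e_sub]
      exact ⟨fun _ => by ring, fun _ => by ring, fun q => by rw [hq q]; ring⟩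
    · intro i₁ i₂ i₃ j₁ j₂ j₃ h1 h2 h3 h12 h13 h23
      refine ⟨.inr (.inl ⟨i₁, i₂, i₃, j₁, j₂, j₃, rfl, ?_, ?_⟩), ?_⟩
      · intro p hp
        apply hSd
        simp only [List.mem_cons, List.not_mem_nil, or_false] at hp
        rcases hp with rfl | rfl | rfl | rfl | rfl | rfl <;> simp only <;> omega
      · simp only [List.pairwise_cons, List.mem_cons, List.not_mem_nil, or_false]
        refine ⟨?_, ?_, ?_, ?_, ?_, by simp⟩ <;> intro p hp <;> apply hSB <;>
          (try rcases hp with rfl | rfl | rfl | rfl | rfl) <;>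
          (try rcases hp with rfl | rfl | rfl | rfl) <;>
          (try rcases hp with rfl | rfl | rfl) <;>
          (try rcases hp with rfl | rfl) <;>
          (try subst hp) <;> simp only <;> omega
      · rw [isMove_iff]
        simp only [Pi.add_apply, Pi.sub_apply, Finset.sum_add_distrib, Finset.sum_sub_distrib,
          e_row, e_col, e_sub]
        refine ⟨fun _ => by ring, fun _ => by ring, fun q => ?_⟩
        have : ∀ i j, ρ i ≠ κ j → (i, j) ∉ Tt ρ κ Nhat q := by
          intro i j hij; simp [Tt, hij]
        rw [if_neg (this _ _ (by omega)), if_neg (this _ _ (by omega)),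
          if_neg (this _ _ (by omega)), if_neg (this _ _ (by omega)),
          if_neg (this _ _ (by omega)), if_neg (this _ _ (by omega))]
        rfl
    · intro i₁ i₂ i₃ j₁ j₂ j₃ k l q hk hl hkl r1 c1 r2 c2 r3 r3' c3 c3'
      have bk := Finset.mem_Icc.1 (hsub q hk)
      have bl := Finset.mem_Icc.1 (hsub q hl)
      refine ⟨.inr (.inr (.inl ⟨i₁, i₂, i₃, j₁, j₂, j₃, rfl,
        ⟨k, l, bk.1, bk.2, bl.1, bl.2, hkl, ?_, ?_⟩, ?_, ?_⟩)), ?_⟩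
      · rw [hblock _ _ _ (by omega) (by omega) (by omega) (by omega)]; exact ⟨r1, c1⟩
      · rw [hblock _ _ _ (by omega) (by omega) (by omega) (by omega)]; exact ⟨r2, c2⟩
      · intro p hp
        apply hSd
        simp only [List.mem_cons, List.not_mem_nil, or_false] at hp
        rcases hp with rfl | rfl | rfl | rfl <;> simp only <;> omega
      · simp only [List.pairwise_cons, List.mem_cons, List.not_mem_nil, or_false]
        refine ⟨?_, ?_, ?_, by simp⟩ <;> intro p hp <;> apply hSB <;>
          (try rcases hp with rfl | rfl | rfl) <;>
          (try rcases hp with rfl | rfl) <;>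
          (try subst hp) <;> simp only <;> omega
      · rw [isMove_iff]
        simp only [Pi.add_apply, Pi.sub_apply, Finset.sum_add_distrib, Finset.sum_sub_distrib,
          e_row, e_col, e_sub]
        refine ⟨fun _ => by ring, fun _ => by ring, fun q' => ?_⟩
        have : ∀ i j, ρ i ≠ κ j → (i, j) ∉ Tt ρ κ Nhat q' := by
          intro i j hij; simp [Tt, hij]
        rw [if_neg (this i₂ j₃ (by omega)), if_neg (this i₃ j₂ (by omega)),
          if_neg (this i₁ j₃ (by omega)), if_neg (this i₃ j₁ (by omega))]
        simp only [Tt, mem_filter, mem_univ, true_and, r1, c1, r2, c2, hlab k l q hk hl q']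
        ring
    · intro i₁ i₂ i₃ i₄ j₁ j₂ j₃ j₄ k l q hk hl hkl r1 r2 c1 r3 r4 c2 c3 c3' c4 c4'
      have bk := Finset.mem_Icc.1 (hsub q hk)
      have bl := Finset.mem_Icc.1 (hsub q hl)
      refine ⟨.inr (.inr (.inr (.inl ⟨i₁, i₂, i₃, i₄, j₁, j₂, j₃, j₄, rfl,
        ⟨k, l, bk.1, bk.2, bl.1, bl.2, hkl, ?_, ?_⟩, ?_, hSR _ _ (by omega),
          hSR _ _ (by omega)⟩))), ?_⟩
      · rw [hblock _ _ _ (by omega) (by omega) (by omega) (by omega)]; exact ⟨r1, c1⟩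
      · rw [hblock _ _ _ (by omega) (by omega) (by omega) (by omega)]; exact ⟨r3, c2⟩
      · intro p hp
        apply hSd
        simp only [List.mem_cons, List.not_mem_nil, or_false] at hp
        rcases hp with rfl | rfl | rfl | rfl | rfl | rfl <;> simp only <;> omega
      · rw [isMove_iff]
        simp only [Pi.add_apply, Pi.sub_apply, Finset.sum_add_distrib, Finset.sum_sub_distrib,
          e_row, e_col, e_sub]
        refine ⟨fun _ => by ring, fun _ => by ring, fun q' => ?_⟩
        have : ∀ i j, ρ i ≠ κ j → (i, j) ∉ Tt ρ κ Nhat q' := by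
          intro i j hij; simp [Tt, hij]
        rw [if_neg (this i₂ j₂ (by omega)), if_neg (this i₃ j₃ (by omega)),
          if_neg (this i₄ j₄ (by omega)), if_neg (this i₁ j₃ (by omega)),
          if_neg (this i₂ j₄ (by omega)), if_neg (this i₄ j₁ (by omega))]
        simp only [Tt, mem_filter, mem_univ, true_and, r1, c1, r3, c2, hlab k l q hk hl q']
        ring
    · intro i₁ i₂ i₃ i₄ j₁ j₂ j₃ j₄ k l q hk hl hkl c1 c2 r1 c3 c4 r2 r3 r3' r4 r4'
      have bk := Finset.mem_Icc.1 (hsub q hk)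
      have bl := Finset.mem_Icc.1 (hsub q hl)
      refine ⟨.inr (.inr (.inr (.inr ⟨j₁, j₂, j₃, j₄, i₁, i₂, i₃, i₄, ?_,
        ⟨k, l, bk.1, bk.2, bl.1, bl.2, hkl, ?_, ?_⟩, ?_, hSR' _ _ (by omega),
          hSR' _ _ (by omega)⟩))), ?_⟩
      · funext p
        simp only [Pi.add_apply, Pi.sub_apply, e_swap]
      · rw [hblock' _ _ _ (by omega) (by omega) (by omega) (by omega)]; exact ⟨c1, r1⟩
      · rw [hblock' _ _ _ (by omega) (by omega) (by omega) (by omega)]; exact ⟨c3, r2⟩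
      · intro p hp
        apply hSd'
        simp only [List.mem_cons, List.not_mem_nil, or_false] at hp
        rcases hp with rfl | rfl | rfl | rfl | rfl | rfl <;> simp only <;> omega
      · rw [isMove_iff]
        simp only [Pi.add_apply, Pi.sub_apply, Finset.sum_add_distrib, Finset.sum_sub_distrib,
          e_row, e_col, e_sub]
        refine ⟨fun _ => by ring, fun _ => by ring, fun q' => ?_⟩
        have : ∀ i j, ρ i ≠ κ j → (i, j) ∉ Tt ρ κ Nhat q' := by
          intro i j hij; simp [Tt, hij]
        rw [if_neg (this i₂ j₂ (by omega)), if_neg (this i₃ j₃ (by omega)),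
          if_neg (this i₄ j₄ (by omega)), if_neg (this i₃ j₁ (by omega)),
          if_neg (this i₄ j₂ (by omega)), if_neg (this i₁ j₄ (by omega))]
        simp only [Tt, mem_filter, mem_univ, true_and, r1, c1, c3, r2, hlab k l q hk hl q']
        ring
  · refine (Set.finite_Icc (fun _ => -4 : Table R C) (fun _ => 4)).subset ?_
    intro z hz
    exact ⟨fun p => (types_bd hz.1 p).1, fun p => (types_bd hz.1 p).2⟩

end Paper
end
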